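/- arXiv:1903.08147 — 3 statements merged into one kernel-verified Lean document; each statement's English description precedes it below -/
import Mathlib

section
/- (Strong Hasse principle.) A nondegenerate quadratic form q on ℚⁿ is isotropic (i.e., has a nonzero zero in ℚⁿ) if and only if its base change to ℝ is isotropic and its base change to ℚ_p is isotropic for every prime p. -/
namespace HM

/-- The ternary diagonal form with integer coefficients is isotropic over `K`. -/
def Iso3 (K : Type) [Field K] (a b c : ℤ) : Prop :=
  ∃ x y z : K, (x ≠ 0 ∨ y ≠ 0 ∨ z ≠ 0) ∧ (a : K) * x ^ 2 + (b : K) * y ^ 2 + (c : K) * z ^ 2 = 0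

/-- The diagonal form with integer coefficients is isotropic over `K`. -/
def Iso (K : Type) [Field K] {n : ℕ} (c : Fin n → ℤ) : Prop :=
  ∃ x : Fin n → K, x ≠ 0 ∧ ∑ i, (c i : K) * x i ^ 2 = 0

section field
variable {K : Type} [Field K]

lemma Iso3.rot {a b c : ℤ} (h : Iso3 K a b c) : Iso3 K b c a := by
  obtain ⟨x, y, z, h0, h⟩ := h
  exact ⟨y, z, x, by tauto, by linear_combination h⟩

lemma Iso3.swap {a b c : ℤ} (h : Iso3 K a b c) : Iso3 K b a c := by
  obtain ⟨x, y, z, h0, h⟩ := h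
  exact ⟨y, x, z, by tauto, by linear_combination h⟩

lemma Iso3.neg {a b c : ℤ} (h : Iso3 K a b c) : Iso3 K (-a) (-b) (-c) := by
  obtain ⟨x, y, z, h0, h⟩ := h
  exact ⟨x, y, z, by tauto, by push_cast; linear_combination -h⟩

variable [CharZero K]

lemma iso3_sq {a b c k : ℤ} (hk : k ≠ 0) : Iso3 K (k ^ 2 * a) b c ↔ Iso3 K a b c := by
  have hk' : (k : K) ≠ 0 := by exact_mod_cast hk
  constructor
  · rintro ⟨x, y, z, h0, h⟩
    refine ⟨k * x, y, z, ?_, by push_cast at h; linear_combination h⟩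
    simpa [hk'] using h0
  · rintro ⟨x, y, z, h0, h⟩
    refine ⟨x / k, y, z, ?_, ?_⟩
    · simpa [hk'] using h0
    · push_cast; field_simp; linear_combination h

lemma iso3_mul {a b c k : ℤ} (hk : k ≠ 0) : Iso3 K (k * a) (k * b) c ↔ Iso3 K a b (k * c) := by
  have hk' : (k : K) ≠ 0 := by exact_mod_cast hk
  constructor
  · rintro ⟨x, y, z, h0, h⟩
    refine ⟨x, y, z / k, ?_, ?_⟩
    · simpa [hk'] using h0
    · push_cast at *; field_simp; linear_combination h
  · rintro ⟨x, y, z, h0, h⟩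
    refine ⟨x, y, k * z, ?_, ?_⟩
    · simpa [hk'] using h0
    · push_cast at *; linear_combination k * h

lemma iso3_one {a b c : ℤ} (hc : c ≠ 0) : Iso3 K a b c ↔ Iso3 K 1 (-(-(a * c))) (-(-(b * c))) := by
  have hk' : (c : K) ≠ 0 := by exact_mod_cast hc
  constructor
  · rintro ⟨x, y, z, h0, h⟩
    refine ⟨c * z, x, y, ?_, ?_⟩
    · simp only [ne_eq, mul_eq_zero, hk']; tauto
    · push_cast at *; linear_combination c * h
  · rintro ⟨x, y, z, h0, h⟩
    refine ⟨y, z, x / c, ?_, ?_⟩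
    · simp only [ne_eq, div_eq_zero_iff, hk']; tauto
    · push_cast at *; field_simp; linear_combination h

/-- Multiplying by a norm from `K(√a)`. -/
lemma iso3_norm {a b b' t : ℤ} (hb : b ≠ 0) (hb' : b' ≠ 0) (h : b * b' = t ^ 2 - a)
    (H : Iso3 K 1 (-a) (-b)) : Iso3 K 1 (-a) (-b') := by
  have hk : (b : K) ≠ 0 := by exact_mod_cast hb
  have hk' : (b' : K) ≠ 0 := by exact_mod_cast hb'
  have h' : (b : K) * b' = t ^ 2 - a := by exact_mod_cast congrArg (Int.cast : ℤ → K) h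
  obtain ⟨x, y, z, h0, H⟩ := H
  push_cast at H
  refine ⟨t * x + a * y, x + t * y, b * z, ?_, ?_⟩
  · by_contra! hh
    obtain ⟨h1, h2, h3⟩ := hh
    have hz : z = 0 := by simpa [hk] using h3
    have hy : (b : K) * b' * y = 0 := by linear_combination h' * y + t * h2 - h1
    have hy : y = 0 := by simpa [hk, hk'] using hy
    have hx : x = 0 := by simpa [hy] using h2
    simp_all
  · push_cast
    linear_combination (t ^ 2 - a) * H - b * z ^ 2 * h'

/-! General diagonal forms. -/

lemma iso_of_tail {n : ℕ} {a : ℤ} {c : Fin n → ℤ} (h : Iso K c) :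
    Iso K (Fin.cons a c : Fin (n + 1) → ℤ) := by
  obtain ⟨x, h0, h⟩ := h
  refine ⟨Fin.cons 0 x, ?_, by simpa [Fin.sum_univ_succ] using h⟩
  contrapose! h0
  funext i
  simpa using congrFun h0 i.succ

lemma iso_of_iso3 {n : ℕ} {c : Fin (n + 3) → ℤ} (h : Iso3 K (c 0) (c 1) (c 2)) : Iso K c := by
  obtain ⟨x, y, z, h0, h⟩ := h
  refine ⟨Fin.cons x (Fin.cons y (Fin.cons z 0)), ?_, ?_⟩
  · intro hh
    have h1 := congrFun hh 0
    have h2 := congrFun hh 1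
    have h3 := congrFun hh 2
    simp only [Fin.cons_zero, Pi.zero_apply] at h1
    have e1 : (1 : Fin (n + 3)) = Fin.succ 0 := rfl
    have e2 : (2 : Fin (n + 3)) = Fin.succ (Fin.succ 0) := rfl
    rw [e1] at h2
    rw [e2] at h3
    simp only [Fin.cons_succ, Fin.cons_zero, Pi.zero_apply] at h2 h3
    simp_all
  · have e1 : (1 : Fin (n + 3)) = Fin.succ 0 := rfl
    have e2 : (2 : Fin (n + 3)) = Fin.succ (Fin.succ 0) := rfl
    rw [e1, e2] at h
    simp only [Fin.sum_univ_succ, Fin.cons_succ, Fin.cons_zero]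
    simp only [Pi.zero_apply]
    simp only [ne_eq, OfNat.ofNat_ne_zero, not_false_eq_true, zero_pow, mul_zero,
      Finset.sum_const_zero, add_zero]
    linear_combination h

lemma iso3_of_iso {c : Fin 3 → ℤ} (h : Iso K c) : Iso3 K (c 0) (c 1) (c 2) := by
  obtain ⟨x, h0, h⟩ := h
  refine ⟨x 0, x 1, x 2, ?_, by simpa [Fin.sum_univ_three] using h⟩
  by_contra! hh
  apply h0
  funext i
  fin_cases i <;> simp [hh]

/-- An isotropic diagonal form is universal. -/
lemma universal {n : ℕ} {c : Fin n → ℤ} (hc : ∀ i, c i ≠ 0) (h : Iso K c) (y : K) :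
    ∃ w : Fin n → K, ∑ i, (c i : K) * w i ^ 2 = y := by
  obtain ⟨x, h0, h⟩ := h
  obtain ⟨j, hj⟩ := Function.ne_iff.mp h0
  simp only [Pi.zero_apply] at hj
  have hcj : (c j : K) ≠ 0 := by exact_mod_cast hc j
  set s : K := (y - c j) / (2 * c j * x j) with hs
  refine ⟨fun i => s * x i + (if i = j then 1 else 0), ?_⟩
  have : ∀ i, (c i : K) * (s * x i + (if i = j then 1 else 0)) ^ 2 =
      s ^ 2 * (c i * x i ^ 2) + (if i = j then 2 * s * c j * x j + c j else 0) := by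
    intro i
    split_ifs with hij
    · subst hij; ring
    · ring
  simp only [this, Finset.sum_add_distrib, ← Finset.mul_sum, h]
  simp [hs]
  field_simp
  ring

lemma common {m : ℕ} {a b : ℤ} {g : Fin (m + 1) → ℤ} (ha : a ≠ 0) (hb : b ≠ 0)
    (hg : ∀ i, g i ≠ 0) (h : Iso K (Fin.cons a (Fin.cons b g) : Fin (m + 3) → ℤ)) :
    ∃ y : K, y ≠ 0 ∧ (∃ u v : K, a * u ^ 2 + b * v ^ 2 = y) ∧
      ∃ w : Fin (m + 1) → K, ∑ i, (g i : K) * w i ^ 2 = -y := by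
  obtain ⟨x, h0, h⟩ := h
  rw [Fin.sum_univ_succ, Fin.sum_univ_succ] at h
  simp only [Fin.cons_succ, Fin.cons_zero] at h
  have ha' : (a : K) ≠ 0 := by exact_mod_cast ha
  have hb' : (b : K) ≠ 0 := by exact_mod_cast hb
  by_cases hy : (a : K) * x 0 ^ 2 + b * x (Fin.succ 0) ^ 2 = 0
  · by_cases hw : (fun i : Fin (m + 1) => x i.succ.succ) = 0
    · have hu : Iso K ![a, b] := by
        refine ⟨![x 0, x (Fin.succ 0)], ?_, by simpa using hy⟩
        intro hh
        apply h0
        have h1 := congrFun hh 0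
        have h2 := congrFun hh 1
        simp only [Matrix.cons_val_zero, Matrix.cons_val_one, Pi.zero_apply] at h1 h2
        funext i
        refine Fin.cases h1 (fun i => Fin.cases h2 (fun i => congrFun hw i) i) i
      have hg0 : (g 0 : K) ≠ 0 := by exact_mod_cast hg 0
      obtain ⟨w, hw⟩ := universal (K := K) (c := ![a, b])
        (by intro i; fin_cases i <;> simp [ha, hb]) hu (-g 0)
      refine ⟨-g 0, by simpa using hg0, ⟨w 0, w 1, by simpa using hw⟩, Pi.single 0 1, ?_⟩
      rw [Fin.sum_univ_succ]
      simp
    · refine ⟨a, ha', ⟨1, 0, by ring⟩, universal hg ⟨_, hw, ?_⟩ _⟩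
      linear_combination h - hy
  · exact ⟨_, hy, ⟨_, _, rfl⟩, fun i => x i.succ.succ, by linear_combination h⟩

lemma iso3_of_rep {a b x : ℤ} {y s : K} (hs : s ≠ 0) (hy : y = x * s ^ 2)
    (h : ∃ u v : K, a * u ^ 2 + b * v ^ 2 = y) : Iso3 K a b (-x) := by
  obtain ⟨u, v, h⟩ := h
  exact ⟨u, v, s, by tauto, by push_cast; linear_combination h + hy⟩

lemma iso_of_rep {m : ℕ} {g : Fin m → ℤ} {x : ℤ} {y s : K} (hs : s ≠ 0) (hy : y = x * s ^ 2)
    (h : ∃ w : Fin m → K, ∑ i, (g i : K) * w i ^ 2 = -y) :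
    Iso K (Fin.cons x g : Fin (m + 1) → ℤ) := by
  obtain ⟨w, h⟩ := h
  refine ⟨Fin.cons s w, fun hh => hs (by simpa using congrFun hh 0), ?_⟩
  rw [Fin.sum_univ_succ]
  simp only [Fin.cons_succ, Fin.cons_zero]
  linear_combination h - hy

lemma iso_combine {m : ℕ} {a b x : ℤ} {g : Fin m → ℤ} (hx : x ≠ 0) (h3 : Iso3 K a b (-x))
    (h : Iso K (Fin.cons x g : Fin (m + 1) → ℤ)) :
    Iso K (Fin.cons a (Fin.cons b g) : Fin (m + 2) → ℤ) := by
  have hx' : (x : K) ≠ 0 := by exact_mod_cast hx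
  obtain ⟨w, hw0, hw⟩ := h
  rw [Fin.sum_univ_succ] at hw
  simp only [Fin.cons_succ, Fin.cons_zero] at hw
  by_cases ht : w 0 = 0
  · apply iso_of_tail
    apply iso_of_tail
    refine ⟨fun i => w i.succ, ?_, by simpa [ht] using hw⟩
    intro hh
    apply hw0
    funext i
    exact Fin.cases ht (fun i => congrFun hh i) i
  obtain ⟨u, v, z, h0, h3⟩ := h3
  push_cast at h3
  by_cases hz : z = 0
  · refine ⟨Fin.cons u (Fin.cons v 0), ?_, ?_⟩
    · intro hh
      have h1 := congrFun hh 0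
      have h2 := congrFun hh (Fin.succ 0)
      simp only [Fin.cons_succ, Fin.cons_zero, Pi.zero_apply] at h1 h2
      simp_all
    · rw [Fin.sum_univ_succ, Fin.sum_univ_succ]
      simp only [Fin.cons_succ, Fin.cons_zero]
      subst hz
      simp only [Pi.zero_apply, ne_eq, OfNat.ofNat_ne_zero, not_false_eq_true, zero_pow, mul_zero,
        Finset.sum_const_zero, add_zero]
      linear_combination h3
  · refine ⟨Fin.cons (u * w 0) (Fin.cons (v * w 0) (fun i => z * w i.succ)), ?_, ?_⟩
    · intro hh
      have h1 := congrFun hh 0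
      have h2 := congrFun hh (Fin.succ 0)
      simp only [Fin.cons_succ, Fin.cons_zero, Pi.zero_apply, mul_eq_zero, ht, or_false] at h1 h2
      subst h1 h2
      simp_all
    · rw [Fin.sum_univ_succ, Fin.sum_univ_succ]
      simp only [Fin.cons_succ, Fin.cons_zero]
      have : ∀ i : Fin m, (g i : K) * (z * w i.succ) ^ 2 = z ^ 2 * (g i * w i.succ ^ 2) := by
        intro i; ring
      simp only [this, ← Finset.mul_sum]
      linear_combination (w 0) ^ 2 * h3 + z ^ 2 * hw

end field

end HM


namespace HM

section padic
variable {p : ℕ} [hp : Fact p.Prime]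

lemma sq_near {t w : ℤ_[p]} (ht : ‖t‖ = 1) (h : ‖t ^ 2 - w‖ < ‖(4 : ℤ_[p])‖) :
    ∃ s : ℤ_[p], s ^ 2 = w := by
  have := hensels_lemma (p := p) (F := (Polynomial.X ^ 2 - Polynomial.C w : Polynomial ℤ_[p]))
    (a := t) (by
      simp only [map_sub, map_pow, Polynomial.aeval_X, Polynomial.aeval_C,
        Polynomial.derivative_X_pow, Polynomial.derivative_C]
      simp only [Algebra.algebraMap_self, RingHom.id_apply]
      refine h.trans_eq ?_
      simp [ht]
      rw [← norm_pow]
      norm_num)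
  obtain ⟨z, hz, -⟩ := this
  refine ⟨z, ?_⟩
  simpa [sub_eq_zero] using hz

lemma norm_four : (p : ℝ) ^ (-(3 : ℕ) : ℤ) < ‖(4 : ℤ_[p])‖ := by
  by_contra! h
  have h' : ‖((4 : ℤ) : ℤ_[p])‖ ≤ (p : ℝ) ^ (-(3 : ℕ) : ℤ) := by exact_mod_cast h
  rw [PadicInt.norm_int_le_pow_iff_dvd] at h'
  have h2 := Int.le_of_dvd (by norm_num) h'
  have h3 : (2 : ℤ) ≤ p := by exact_mod_cast hp.out.two_le
  have : (2 : ℤ) ^ 3 ≤ p ^ 3 := pow_le_pow_left₀ (by norm_num) h3 3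
  push_cast at *
  omega

lemma toZMod_eq_zero {x : ℤ_[p]} : PadicInt.toZMod x = 0 ↔ ‖x‖ < 1 := by
  rw [← RingHom.mem_ker, PadicInt.ker_toZMod, PadicInt.norm_lt_one_iff_dvd,
    PadicInt.maximalIdeal_eq_span_p, Ideal.mem_span_singleton]

lemma norm_four_odd (h2 : p ≠ 2) : ‖(4 : ℤ_[p])‖ = 1 := by
  have : ‖((4 : ℤ) : ℤ_[p])‖ = 1 := by
    rw [PadicInt.norm_intCast_eq_one_iff]
    have : Nat.Coprime 2 p := (Nat.coprime_primes Nat.prime_two hp.out).mpr h2.symm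
    have := this.pow_left 2
    exact_mod_cast this.isCoprime
  exact_mod_cast this

lemma sq_lift (h2 : p ≠ 2) {w : ℤ_[p]} (hw : PadicInt.toZMod w ≠ 0)
    (h : IsSquare (PadicInt.toZMod w)) : ∃ s : ℤ_[p], s ≠ 0 ∧ s ^ 2 = w := by
  obtain ⟨r, hr⟩ := h
  have hr0 : r ≠ 0 := by rintro rfl; simp_all
  obtain ⟨t, rfl⟩ := ZMod.ringHom_surjective (PadicInt.toZMod (p := p)) r
  have ht : ‖t‖ = 1 := by
    rw [Ne, toZMod_eq_zero] at hr0
    exact le_antisymm (PadicInt.norm_le_one t) (not_lt.mp hr0)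
  obtain ⟨s, hs⟩ := sq_near (w := w) ht (by
    rw [norm_four_odd h2, ← toZMod_eq_zero]
    simp [hr, sq])
  refine ⟨s, ?_, hs⟩
  rintro rfl
  apply hw
  rw [← hs]; simp

lemma cast_ne_zero {a : ℤ} (h : ¬ (p : ℤ) ∣ a) : (a : ZMod p) ≠ 0 := by
  rwa [Ne, ZMod.intCast_zmod_eq_zero_iff_dvd]

/-- good reduction -/
lemma iso3_unit (h2 : p ≠ 2) {a b c : ℤ} (ha : ¬ (p : ℤ) ∣ a) (hb : ¬ (p : ℤ) ∣ b)
    (hc : ¬ (p : ℤ) ∣ c) : Iso3 ℚ_[p] a b c := by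
  have ha' := cast_ne_zero ha
  have hb' := cast_ne_zero hb
  have hc' := cast_ne_zero hc
  have : ∃ y z : ZMod p, (b : ZMod p) * y ^ 2 + c * z ^ 2 + a = 0 := by
    obtain ⟨y, z, h⟩ := FiniteField.exists_root_sum_quadratic (R := ZMod p)
      (f := Polynomial.C (b : ZMod p) * Polynomial.X ^ 2 + Polynomial.C 0 * Polynomial.X
        + Polynomial.C 0)
      (g := Polynomial.C (c : ZMod p) * Polynomial.X ^ 2 + Polynomial.C 0 * Polynomial.X
        + Polynomial.C (a : ZMod p))
      (Polynomial.degree_quadratic hb') (Polynomial.degree_quadratic hc')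
      (by rw [ZMod.card]; exact hp.out.mod_two_eq_one_iff_ne_two.mpr h2)
    refine ⟨y, z, ?_⟩
    simp at h
    linear_combination h
  obtain ⟨y, z, h⟩ := this
  obtain ⟨y, rfl⟩ := ZMod.ringHom_surjective (PadicInt.toZMod (p := p)) y
  obtain ⟨z, rfl⟩ := ZMod.ringHom_surjective (PadicInt.toZMod (p := p)) z
  have e : PadicInt.toZMod (-(a : ℤ_[p]) * ((b : ℤ_[p]) * y ^ 2 + (c : ℤ_[p]) * z ^ 2)) =
      (a : ZMod p) * (a : ZMod p) := by
    simp only [map_mul, map_neg, map_add, map_pow, map_intCast]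
    linear_combination -(a : ZMod p) * h
  obtain ⟨s, hs0, hs⟩ := sq_lift h2 (w := -(a : ℤ_[p]) * (b * y ^ 2 + c * z ^ 2))
    (by rw [e]; exact mul_ne_zero ha' ha') ⟨_, e⟩
  have ha0 : (a : ℚ_[p]) ≠ 0 := by
    have : a ≠ 0 := by rintro rfl; simp at ha
    exact_mod_cast this
  have hs' : (s : ℚ_[p]) ^ 2 = -(a : ℚ_[p]) * (b * y ^ 2 + c * z ^ 2) := by
    exact_mod_cast congrArg (fun x : ℤ_[p] => (x : ℚ_[p])) hs
  refine ⟨s / a, y, z, Or.inl (div_ne_zero ?_ ha0), ?_⟩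
  · exact fun h => hs0 (Subtype.ext h)
  · field_simp
    linear_combination hs'

lemma iso3_sqmod (h2 : p ≠ 2) {a b c : ℤ} (hb : ¬ (p : ℤ) ∣ b)
    (hc : ¬ (p : ℤ) ∣ c) (h : IsSquare ((-(b * c) : ℤ) : ZMod p)) : Iso3 ℚ_[p] a b c := by
  have hb' := cast_ne_zero hb
  have hc' := cast_ne_zero hc
  obtain ⟨s, hs0, hs⟩ := sq_lift h2 (w := ((-(b * c) : ℤ) : ℤ_[p]))
    (by simp [hb', hc']) (by simpa using h)
  have hs' : (s : ℚ_[p]) ^ 2 = ((-(b * c) : ℤ) : ℚ_[p]) := by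
    exact_mod_cast congrArg (fun x : ℤ_[p] => (x : ℚ_[p])) hs
  push_cast at hs'
  refine ⟨0, s, b, Or.inr (Or.inl ?_), ?_⟩
  · exact fun h => hs0 (Subtype.ext h)
  · linear_combination b * hs'

lemma prim_aux {a b c : ℤ} {x y z : ℚ_[p]} (hx : x ≠ 0) (hy : ‖y‖ ≤ ‖x‖) (hz : ‖z‖ ≤ ‖x‖)
    (h : (a : ℚ_[p]) * x ^ 2 + b * y ^ 2 + c * z ^ 2 = 0) :
    ∃ y z : ℤ_[p], (a : ℤ_[p]) * 1 ^ 2 + b * y ^ 2 + c * z ^ 2 = 0 := by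
  have hx' : 0 < ‖x‖ := norm_pos_iff.mpr hx
  obtain ⟨Y, hY⟩ : ∃ Y : ℤ_[p], (Y : ℚ_[p]) = y / x :=
    ⟨⟨y / x, by rw [norm_div]; exact (div_le_one hx').mpr hy⟩, rfl⟩
  obtain ⟨Z, hZ⟩ : ∃ Z : ℤ_[p], (Z : ℚ_[p]) = z / x :=
    ⟨⟨z / x, by rw [norm_div]; exact (div_le_one hx').mpr hz⟩, rfl⟩
  refine ⟨Y, Z, ?_⟩
  apply Subtype.ext
  push_cast
  rw [hY, hZ]
  field_simp
  linear_combination h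

lemma prim {a b c : ℤ} (h : Iso3 ℚ_[p] a b c) :
    ∃ x y z : ℤ_[p], (x = 1 ∨ y = 1 ∨ z = 1) ∧
      (a : ℤ_[p]) * x ^ 2 + b * y ^ 2 + c * z ^ 2 = 0 := by
  obtain ⟨x, y, z, h0, h⟩ := h
  have key : (‖y‖ ≤ ‖x‖ ∧ ‖z‖ ≤ ‖x‖) ∨ (‖x‖ ≤ ‖y‖ ∧ ‖z‖ ≤ ‖y‖) ∨ (‖x‖ ≤ ‖z‖ ∧ ‖y‖ ≤ ‖z‖) := by
    rcases le_total ‖x‖ ‖y‖ with h1 | h1 <;> rcases le_total ‖x‖ ‖z‖ with h2 | h2 <;>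
      rcases le_total ‖y‖ ‖z‖ with h3 | h3 <;> grind
  have nz : ∀ u v : ℚ_[p], ‖v‖ ≤ ‖u‖ → u = 0 → v = 0 := by
    rintro u v h rfl
    simpa using h
  rcases key with ⟨h1, h2⟩ | ⟨h1, h2⟩ | ⟨h1, h2⟩
  · have hx : x ≠ 0 := fun hx => by simp [nz _ _ h1 hx, nz _ _ h2 hx, hx] at h0
    obtain ⟨y, z, h⟩ := prim_aux hx h1 h2 h
    exact ⟨1, y, z, by simp, h⟩
  · have hx : y ≠ 0 := fun hx => by simp [nz _ _ h1 hx, nz _ _ h2 hx, hx] at h0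
    obtain ⟨y, z, h⟩ := prim_aux (a := b) (b := a) (c := c) hx h1 h2 (by linear_combination h)
    exact ⟨y, 1, z, by simp, by linear_combination h⟩
  · have hx : z ≠ 0 := fun hx => by simp [nz _ _ h1 hx, nz _ _ h2 hx, hx] at h0
    obtain ⟨y, z, h⟩ := prim_aux (a := c) (b := a) (c := b) hx h1 h2 (by linear_combination h)
    exact ⟨y, z, 1, by simp, by linear_combination h⟩

/-- The necessary condition at a prime exactly dividing the first coefficient. -/
lemma isSquare_of_iso3 {a b c : ℤ} (ha : (p : ℤ) ∣ a) (ha2 : ¬ (p : ℤ) ^ 2 ∣ a)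
    (h : Iso3 ℚ_[p] a b c) : IsSquare ((-(b * c) : ℤ) : ZMod p) := by
  by_cases hb : (p : ℤ) ∣ b
  · have : ((b : ℤ) : ZMod p) = 0 := by rwa [ZMod.intCast_zmod_eq_zero_iff_dvd]
    simp [this]
  by_cases hc : (p : ℤ) ∣ c
  · have : ((c : ℤ) : ZMod p) = 0 := by rwa [ZMod.intCast_zmod_eq_zero_iff_dvd]
    simp [this]
  have hb' := cast_ne_zero hb
  have hc' := cast_ne_zero hc
  obtain ⟨x, y, z, h0, h⟩ := prim h
  have hm := congrArg (PadicInt.toZMod (p := p)) h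
  have ha' : ((a : ℤ) : ZMod p) = 0 := by rwa [ZMod.intCast_zmod_eq_zero_iff_dvd]
  simp only [map_add, map_mul, map_pow, map_intCast, ha', map_zero, zero_mul, zero_add] at hm
  by_cases hz : PadicInt.toZMod z = 0
  · exfalso
    have hy : PadicInt.toZMod y = 0 := by simpa [hz, hb'] using hm
    have hz1 : z ≠ 1 := by rintro rfl; simp at hz
    have hy1 : y ≠ 1 := by rintro rfl; simp at hy
    have hx : x = 1 := by tauto
    subst hx
    rw [toZMod_eq_zero, PadicInt.norm_lt_one_iff_dvd] at hy hz
    obtain ⟨y, rfl⟩ := hy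
    obtain ⟨z, rfl⟩ := hz
    apply ha2
    have : (p : ℤ_[p]) ^ 2 ∣ (a : ℤ_[p]) := ⟨-(b * y ^ 2 + c * z ^ 2), by linear_combination h⟩
    have h3 : ‖(a : ℤ_[p])‖ ≤ (p : ℝ) ^ (-(2 : ℕ) : ℤ) := by
      rw [PadicInt.norm_le_pow_iff_mem_span_pow, Ideal.mem_span_singleton]
      exact this
    rw [PadicInt.norm_int_le_pow_iff_dvd] at h3
    exact_mod_cast h3
  · refine ⟨b * PadicInt.toZMod y / PadicInt.toZMod z, ?_⟩
    push_cast
    field_simp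
    linear_combination -hm

lemma even_val {z : ℚ_[p]} (hz : z ≠ 0) {k : ℤ} (hk : z.valuation = 2 * k) :
    ∃ m : ℕ, ¬ p ∣ m ∧ ∀ n : ℕ, n ≡ m [MOD p ^ 3] → ∃ s : ℚ_[p], s ≠ 0 ∧ z = n * s ^ 2 := by
  have hp0 : (p : ℚ_[p]) ≠ 0 := by exact_mod_cast hp.out.ne_zero
  have hpr : (p : ℝ) ≠ 0 := by exact_mod_cast hp.out.ne_zero
  have hU : ‖z * ((p : ℚ_[p]) ^ (-k)) ^ 2‖ = 1 := by
    rw [norm_mul, Padic.norm_eq_zpow_neg_valuation hz, norm_pow, norm_zpow, Padic.norm_p, hk]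
    rw [inv_zpow', ← zpow_natCast, ← zpow_mul, ← zpow_add₀ hpr]
    convert zpow_zero _
    push_cast; ring
  set U : ℤ_[p] := ⟨_, hU.le⟩ with hUdef
  have hUn : ‖U‖ = 1 := hU
  have near : ∀ n : ℕ, n ≡ U.appr 3 [MOD p ^ 3] → ‖U - n‖ ≤ (p : ℝ) ^ (-(3 : ℕ) : ℤ) := by
    intro n hn
    have h1 := PadicInt.appr_spec 3 U
    rw [PadicInt.norm_le_pow_iff_mem_span_pow]
    have h2 : ((U.appr 3 : ℤ_[p]) - n) ∈ Ideal.span {(p : ℤ_[p]) ^ 3} := by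
      rw [Ideal.mem_span_singleton]
      obtain ⟨d, hd⟩ := (Nat.modEq_iff_dvd.mp hn)
      refine ⟨d, ?_⟩
      exact_mod_cast congrArg (Int.cast : ℤ → ℤ_[p]) hd
    have := Ideal.add_mem _ h1 h2
    simpa using this
  have unit : ∀ n : ℕ, n ≡ U.appr 3 [MOD p ^ 3] → ‖(n : ℤ_[p])‖ = 1 := by
    intro n hn
    have h1 := near n hn
    have h2 : ‖U - n‖ < 1 := by
      refine (h1.trans_lt norm_four).trans_le (PadicInt.norm_le_one _)
    by_contra h
    have h3 : ‖(n : ℤ_[p])‖ < 1 := lt_of_le_of_ne (PadicInt.norm_le_one _) h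
    have := PadicInt.norm_lt_one_add h2 h3
    simp [hUn] at this
  refine ⟨U.appr 3, ?_, ?_⟩
  · rw [← PadicInt.norm_natCast_lt_one_iff (p := p), unit _ rfl]
    simp
  · intro n hn
    obtain ⟨r, hr⟩ := sq_near (t := U) (w := n * U) hUn (by
      have : U ^ 2 - n * U = (U - n) * U := by ring
      rw [this, norm_mul, hUn, mul_one]
      exact (near n hn).trans_lt norm_four)
    have hn0 : (n : ℚ_[p]) ≠ 0 := by
      have := unit n hn
      have : n ≠ 0 := by rintro rfl; simp at this
      exact_mod_cast this
    have hr' : (r : ℚ_[p]) ^ 2 = n * (z * ((p : ℚ_[p]) ^ (-k)) ^ 2) := by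
      exact_mod_cast congrArg (fun x : ℤ_[p] => (x : ℚ_[p])) hr
    have hpk : (p : ℚ_[p]) ^ k ≠ 0 := zpow_ne_zero _ hp0
    rw [zpow_neg] at hr'
    have hzz : z = n * (r * (p : ℚ_[p]) ^ k / n) ^ 2 := by
      field_simp at hr' ⊢
      linear_combination -hr'
    refine ⟨_, ?_, hzz⟩
    rintro h
    rw [h] at hzz
    simp at hzz
    exact hz hzz

end padic

lemma prim_two {a b c : ℤ} (h : Iso3 ℚ_[2] a b c) :
    ∃ x y z : ZMod 8, (x = 1 ∨ y = 1 ∨ z = 1) ∧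
      (a : ZMod 8) * x ^ 2 + b * y ^ 2 + c * z ^ 2 = 0 := by
  obtain ⟨x, y, z, h0, h⟩ := prim h
  let f : ℤ_[2] →+* ZMod 8 := PadicInt.toZModPow 3
  refine ⟨f x, f y, f z, ?_, ?_⟩
  · rcases h0 with rfl | rfl | rfl <;> simp
  · simpa using congrArg f h

end HM


namespace HM

lemma sq_mod_squarefree (a : ℤ) (m : ℕ) (hm : Squarefree m)
    (h : ∀ p : ℕ, p.Prime → p ∣ m → IsSquare (a : ZMod p)) : ∃ t : ℤ, (m : ℤ) ∣ t ^ 2 - a := by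
  induction m using induction_on_primes with
  | zero => simp at hm
  | one => exact ⟨0, by simp⟩
  | prime_mul p m hp ih =>
    obtain ⟨hcop, -, hm'⟩ := Nat.squarefree_mul_iff.mp hm
    obtain ⟨t2, ht2⟩ := ih hm' (fun q hq hqm => h q hq (Dvd.dvd.mul_left hqm p))
    obtain ⟨r, hr⟩ := h p hp (dvd_mul_right _ _)
    have ht1 : ∃ t1 : ℤ, (p : ℤ) ∣ t1 ^ 2 - a := by
      obtain ⟨t1, rfl⟩ := ZMod.intCast_surjective r
      refine ⟨t1, ?_⟩
      rw [← ZMod.intCast_zmod_eq_zero_iff_dvd]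
      push_cast
      rw [hr]; ring
    obtain ⟨t1, ht1⟩ := ht1
    have hc : IsCoprime (p : ℤ) (m : ℤ) := hcop.isCoprime
    have hc' := hc
    obtain ⟨u, v, huv⟩ := hc'
    refine ⟨t1 * (v * m) + t2 * (u * p), ?_⟩
    push_cast
    apply hc.mul_dvd
    · obtain ⟨d, hd⟩ := ht1
      have e : v * m = 1 - u * p := by linear_combination huv
      rw [e]
      exact ⟨d + (t2 - t1) * u * (2 * t1 + (t2 - t1) * (u * p)), by linear_combination hd⟩
    · obtain ⟨d, hd⟩ := ht2
      have e : u * p = 1 - v * m := by linear_combination huv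
      rw [e]
      exact ⟨d + (t1 - t2) * v * (2 * t2 + (t1 - t2) * (v * m)), by linear_combination hd⟩

lemma exists_sq_of_not_squarefree {a : ℤ} (ha : a ≠ 0) (h : ¬ Squarefree a) :
    ∃ k a' : ℤ, k ≠ 0 ∧ a' ≠ 0 ∧ a = k ^ 2 * a' ∧ a'.natAbs < a.natAbs := by
  unfold Squarefree at h
  push Not at h
  obtain ⟨k, ⟨a', rfl⟩, hk⟩ := h
  have hk0 : k ≠ 0 := by rintro rfl; simp at ha
  have ha' : a' ≠ 0 := by rintro rfl; simp at ha
  refine ⟨k, a', hk0, ha', by ring, ?_⟩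
  have h1 : k.natAbs ≠ 1 := by rwa [Int.isUnit_iff_natAbs_eq] at hk
  have h2 : k.natAbs ≠ 0 := by simpa using hk0
  have h3 : a'.natAbs ≠ 0 := by simpa using ha'
  rw [Int.natAbs_mul, Int.natAbs_mul]
  have : 2 ≤ k.natAbs := by omega
  have h4 : 2 * 2 ≤ k.natAbs * k.natAbs := Nat.mul_le_mul this this
  have := Nat.mul_le_mul_right a'.natAbs h4
  omega

lemma real_iso3_not_pos {a b c : ℤ} (ha : 0 < a) (hb : 0 < b) (hc : 0 < c) : ¬ Iso3 ℝ a b c := by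
  rintro ⟨x, y, z, h0, h⟩
  have ha' : (0 : ℝ) < a := by exact_mod_cast ha
  have hb' : (0 : ℝ) < b := by exact_mod_cast hb
  have hc' : (0 : ℝ) < c := by exact_mod_cast hc
  have h1 := mul_nonneg ha'.le (sq_nonneg x)
  have h2 := mul_nonneg hb'.le (sq_nonneg y)
  have h3 := mul_nonneg hc'.le (sq_nonneg z)
  rcases h0 with h0 | h0 | h0
  · have := mul_pos ha' (sq_pos_of_ne_zero h0); linarith
  · have := mul_pos hb' (sq_pos_of_ne_zero h0); linarith
  · have := mul_pos hc' (sq_pos_of_ne_zero h0); linarith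

/-- Legendre's theorem, in the form of the ternary Hasse principle. -/
theorem legendre_aux (N : ℕ) : ∀ a b : ℤ, a ≠ 0 → b ≠ 0 → a.natAbs + b.natAbs ≤ N →
    Iso3 ℝ 1 (-a) (-b) → (∀ (p : ℕ) [Fact p.Prime], Iso3 ℚ_[p] 1 (-a) (-b)) →
    Iso3 ℚ 1 (-a) (-b) := by
  induction N with
  | zero => intro a b ha hb h; exfalso; omega
  | succ N ih =>
    -- it suffices to treat `|a| ≤ |b|`
    have main : ∀ a b : ℤ, a ≠ 0 → b ≠ 0 → a.natAbs + b.natAbs ≤ N + 1 → a.natAbs ≤ b.natAbs →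
        Iso3 ℝ 1 (-a) (-b) → (∀ (p : ℕ) [Fact p.Prime], Iso3 ℚ_[p] 1 (-a) (-b)) →
        Iso3 ℚ 1 (-a) (-b) := by
      intro a b ha hb hN hab hR hp
      by_cases hb1 : b.natAbs = 1
      · have ha1 : a.natAbs = 1 := by omega
        rcases Int.natAbs_eq a with h1 | h1 <;> rw [ha1] at h1
        · exact ⟨1, 1, 0, by simp, by rw [h1]; norm_num⟩
        rcases Int.natAbs_eq b with h2 | h2 <;> rw [hb1] at h2
        · exact ⟨1, 0, 1, by simp, by rw [h2]; norm_num⟩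
        · exact absurd hR (real_iso3_not_pos (by norm_num) (by omega) (by omega))
      by_cases hsq : Squarefree b
      swap
      · obtain ⟨k, b', hk, hb', hbk, hlt⟩ := exists_sq_of_not_squarefree hb hsq
        have key : ∀ (K : Type) [Field K] [CharZero K],
            Iso3 K 1 (-a) (-b) ↔ Iso3 K 1 (-a) (-b') := by
          intro K _ _
          have e : -b = k ^ 2 * (-b') := by rw [hbk]; ring
          rw [e]
          constructor
          · intro h
            exact ((iso3_sq hk).mp h.rot.rot).rot
          · intro h
            exact ((iso3_sq hk).mpr h.rot.rot).rot
        rw [key]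
        exact ih a b' ha hb' (by omega) ((key _).mp hR) (fun p _ => (key _).mp (hp p))
      have hb2 : 2 ≤ b.natAbs := by have : b.natAbs ≠ 0 := by simpa using hb
                                    omega
      obtain ⟨t0, ht0⟩ := sq_mod_squarefree a b.natAbs (Int.squarefree_natAbs.mpr hsq) (by
        intro p hpp hpb
        have : Fact p.Prime := ⟨hpp⟩
        have h1 : (p : ℤ) ∣ -b := by rw [dvd_neg]; exact Int.natCast_dvd.mpr hpb
        have h2 : ¬ (p : ℤ) ^ 2 ∣ -b := by
          rw [dvd_neg]
          intro h
          have := hsq p (by rwa [sq] at h)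
          rw [Int.isUnit_iff_natAbs_eq] at this
          simp at this
          exact hpp.one_lt.ne' this
        have := isSquare_of_iso3 h1 h2 (hp p).rot.rot
        simpa using this)
      set t := Int.bmod t0 b.natAbs with ht
      have hd : b ∣ t ^ 2 - a := by
        rw [← Int.natAbs_dvd]
        have h1 : (b.natAbs : ℤ) ∣ t - t0 := Int.dvd_bmod_sub_self
        have h2 : t ^ 2 - a = (t - t0) * (t + t0) + (t0 ^ 2 - a) := by ring
        rw [h2]
        exact dvd_add (Dvd.dvd.mul_right h1 _) ht0
      have hlo : -((b.natAbs : ℤ) / 2) ≤ t := Int.le_bmod (by omega)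
      have hhi : t < ((b.natAbs : ℤ) + 1) / 2 := Int.bmod_lt (by omega)
      obtain ⟨b', hb'⟩ := hd
      by_cases hb0 : b' = 0
      · refine ⟨t, 1, 0, by simp, ?_⟩
        have : t ^ 2 = a := by rw [hb0] at hb'; linarith
        have : (t : ℚ) ^ 2 = a := by exact_mod_cast this
        push_cast
        linear_combination this
      have hlt : b'.natAbs < b.natAbs := by
        by_contra! hge
        have e1 : (b.natAbs : ℤ) = |b| := Int.natCast_natAbs b
        have e2 : (a.natAbs : ℤ) = |a| := Int.natCast_natAbs a
        have e3 : (b'.natAbs : ℤ) = |b'| := Int.natCast_natAbs b'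
        have f1 : |a| ≤ |b| := by rw [← e1, ← e2]; exact_mod_cast hab
        have f2 : |b| ≤ |b'| := by rw [← e1, ← e3]; exact_mod_cast hge
        have f3 : 2 ≤ |b| := by rw [← e1]; exact_mod_cast hb2
        have f4 : |b| * |b'| ≤ t ^ 2 + |a| := by
          rw [← abs_mul, ← hb']
          calc |t ^ 2 - a| ≤ |t ^ 2| + |a| := abs_sub _ _
            _ = _ := by rw [abs_of_nonneg (sq_nonneg t)]
        rw [e1] at hlo hhi
        have f5 : 2 * |t| ≤ |b| := by
          rcases abs_cases t with ⟨h, _⟩ | ⟨h, _⟩ <;> rw [h] <;> omega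
        have f6 : 4 * t ^ 2 ≤ |b| ^ 2 := by
          rw [← sq_abs t]
          nlinarith [abs_nonneg t]
        nlinarith
      have hnorm : b * b' = t ^ 2 - a := hb'.symm
      refine iso3_norm hb0 hb (t := t) (by rw [mul_comm]; exact hnorm) ?_
      exact ih a b' ha hb0 (by omega) (iso3_norm hb hb0 hnorm hR)
        (fun p _ => iso3_norm hb hb0 hnorm (hp p))
    intro a b ha hb hN hR hp
    rcases le_total a.natAbs b.natAbs with h | h
    · exact main a b ha hb hN h hR hp
    · exact (main b a hb ha (by omega) h hR.swap.rot
        (fun p _ => (hp p).swap.rot)).swap.rot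

theorem ternary {a b c : ℤ} (ha : a ≠ 0) (hb : b ≠ 0) (hc : c ≠ 0) (hR : Iso3 ℝ a b c)
    (hp : ∀ (p : ℕ) [Fact p.Prime], Iso3 ℚ_[p] a b c) : Iso3 ℚ a b c := by
  rw [iso3_one hc] at hR ⊢
  exact legendre_aux _ _ _ (by simp [ha, hc]) (by simp [hb, hc]) le_rfl hR
    (fun p _ => (iso3_one hc).mp (hp p))

end HM


namespace HM
open NumberTheorySymbols ZMod

lemma jac_one (N : ℤ) (m : ℕ) (hm : m ≠ 0)
    (h : ∀ p : ℕ, p.Prime → p ∣ m → IsSquare (N : ZMod p) ∧ ¬ (p : ℤ) ∣ N) : J(N | m) = 1 := by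
  induction m using induction_on_primes with
  | zero => simp at hm
  | one => simp
  | prime_mul p m hp ih =>
    have : Fact p.Prime := ⟨hp⟩
    have hm0 : m ≠ 0 := by rintro rfl; simp at hm
    rw [jacobiSym.mul_right' N hp.ne_zero hm0,
      ih hm0 (fun q hq hqm => h q hq (Dvd.dvd.mul_left hqm p)), mul_one,
      ← jacobiSym.legendreSym.to_jacobiSym]
    obtain ⟨h1, h2⟩ := h p hp (dvd_mul_right _ _)
    exact (legendreSym.eq_one_iff p (cast_ne_zero h2)).mpr h1

/-- sign in quadratic reciprocity -/
def E (a b : ℕ) : ℤ := if a % 4 = 3 ∧ b % 4 = 3 then -1 else 1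
/-- the character mod 4 -/
def X4 (a : ℕ) : ℤ := if a % 4 = 3 then -1 else 1
/-- the character mod 8 -/
def X8 (a : ℕ) : ℤ := if a % 8 = 3 ∨ a % 8 = 5 then -1 else 1

lemma E_mod (a b : ℕ) : E a b = E (a % 8) (b % 8) := by
  unfold E
  have h1 : a % 8 % 4 = a % 4 := by omega
  have h2 : b % 8 % 4 = b % 4 := by omega
  rw [h1, h2]

lemma X4_mod (a : ℕ) : X4 a = X4 (a % 8) := by
  unfold X4
  have h1 : a % 8 % 4 = a % 4 := by omega
  rw [h1]

lemma X8_mod (a : ℕ) : X8 a = X8 (a % 8) := by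
  unfold X8
  simp

lemma qr {a b : ℕ} (ha : a % 2 = 1) (hb : b % 2 = 1) (hc : a.Coprime b) :
    J(a | b) * J(b | a) = E a b := by
  have h := jacobiSym.quadratic_reciprocity_if ha hb
  have h1 : J(b | a) ^ 2 = 1 := jacobiSym.sq_one (by simpa [Nat.coprime_comm] using hc.symm)
  rw [← h, E]
  split_ifs
  · linear_combination -h1
  · linear_combination h1

lemma j_two {b : ℕ} (hb : b % 2 = 1) : J(2 | b) = X8 b := by
  rw [jacobiSym.at_two (Nat.odd_iff.mpr hb), χ₈_nat_eq_if_mod_eight, X8]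
  have : b % 8 = 1 ∨ b % 8 = 3 ∨ b % 8 = 5 ∨ b % 8 = 7 := by omega
  rcases this with h | h | h | h <;> simp [h, hb]

lemma j_neg_one {b : ℕ} (hb : b % 2 = 1) : J(-1 | b) = X4 b := by
  rw [jacobiSym.at_neg_one (Nat.odd_iff.mpr hb), χ₄_nat_eq_if_mod_four, X4]
  have : b % 4 = 1 ∨ b % 4 = 3 := by omega
  rcases this with h | h <;> simp [h, hb]

lemma j_at_two {N : ℤ} (hN : N % 2 = 1) : J(N | 2) = 1 := by
  apply jac_one _ _ (by norm_num)
  intro p hp hpd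
  have : p = 2 := (Nat.prime_dvd_prime_iff_eq hp Nat.prime_two).mp hpd
  subst this
  refine ⟨?_, by omega⟩
  have : ∀ x : ZMod 2, IsSquare x := by decide
  exact this _

/-- The combination of Jacobi symbols for odd coefficients. -/
lemma odd_formula {A B C : ℕ} (hA : A % 2 = 1) (hB : B % 2 = 1) (hC : C % 2 = 1)
    (hAB : A.Coprime B) (hAC : A.Coprime C) (hBC : B.Coprime C) :
    J((B : ℤ) * C | A) * J((A : ℤ) * C | B) * J(-((A : ℤ) * B) | C) =
      E A B * E A C * E B C * X4 C := by
  have e : -((A : ℤ) * B) = -1 * (A * B) := by ring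
  rw [e]
  simp only [jacobiSym.mul_left]
  rw [j_neg_one hC, ← qr hA hB hAB, ← qr hA hC hAC, ← qr hB hC hBC]
  ring

lemma two_adic {A B C : ℕ} (h : ∃ x y z : ZMod 8, (x = 1 ∨ y = 1 ∨ z = 1) ∧
      (A : ZMod 8) * x ^ 2 + B * y ^ 2 - C * z ^ 2 = 0) :
    ∃ x ∈ [0, 1, 4], ∃ y ∈ [0, 1, 4], ∃ z ∈ [0, 1, 4], (x = 1 ∨ y = 1 ∨ z = 1) ∧
      ((A % 8) * x + (B % 8) * y + 7 * (C % 8) * z) % 8 = 0 := by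
  obtain ⟨x, y, z, h0, h⟩ := h
  have sq : ∀ x : ZMod 8, ∃ n ∈ [0, 1, 4], x ^ 2 = ((n : ℕ) : ZMod 8) ∧ (x = 1 → n = 1) := by
    decide
  obtain ⟨X, hX, hx, hx1⟩ := sq x
  obtain ⟨Y, hY, hy, hy1⟩ := sq y
  obtain ⟨Z, hZ, hz, hz1⟩ := sq z
  refine ⟨X, hX, Y, hY, Z, hZ, by tauto, ?_⟩
  rw [hx, hy, hz] at h
  apply Nat.mod_eq_zero_of_dvd
  rw [← ZMod.natCast_eq_zero_iff]
  have m : ∀ n : ℕ, ((n % 8 : ℕ) : ZMod 8) = n := fun n => ZMod.natCast_mod n 8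
  have e : ((7 : ℕ) : ZMod 8) = -1 := by decide
  simp only [Nat.cast_add, Nat.cast_mul, m, e]
  linear_combination h

lemma dec1 : ∀ a ∈ [1, 3, 5, 7], ∀ b ∈ [1, 3, 5, 7], ∀ c ∈ [1, 3, 5, 7],
    (∃ x ∈ [0, 1, 4], ∃ y ∈ [0, 1, 4], ∃ z ∈ [0, 1, 4], (x = 1 ∨ y = 1 ∨ z = 1) ∧
      (a * x + b * y + 7 * c * z) % 8 = 0) → E a b * E a c * E b c * X4 c = 1 := by
  decide

lemma dec2 : ∀ a ∈ [1, 3, 5, 7], ∀ b ∈ [1, 3, 5, 7], ∀ c ∈ [1, 3, 5, 7],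
    (∃ x ∈ [0, 1, 4], ∃ y ∈ [0, 1, 4], ∃ z ∈ [0, 1, 4], (x = 1 ∨ y = 1 ∨ z = 1) ∧
      ((2 * a % 8) * x + b * y + 7 * c * z) % 8 = 0) →
      E a b * E a c * E b c * X4 c * (X8 b * X8 c) = 1 := by
  decide

lemma dec3 : ∀ a ∈ [1, 3, 5, 7], ∀ b ∈ [1, 3, 5, 7], ∀ c ∈ [1, 3, 5, 7],
    (∃ x ∈ [0, 1, 4], ∃ y ∈ [0, 1, 4], ∃ z ∈ [0, 1, 4], (x = 1 ∨ y = 1 ∨ z = 1) ∧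
      (a * x + b * y + 7 * (2 * c % 8) * z) % 8 = 0) →
      E a b * E a c * E b c * X4 c * (X8 a * X8 b) = 1 := by
  decide

lemma odd_mem {a : ℕ} (h : a % 2 = 1) : a % 8 ∈ [1, 3, 5, 7] := by
  simp only [List.mem_cons, List.not_mem_nil, or_false]; omega

/-- The reciprocity formula for positive `A, B, C` and the form `⟨A, B, -C⟩`. -/
def Rec (A B C : ℕ) : Prop :=
  J((B : ℤ) * C | A) * J((A : ℤ) * C | B) * J(-((A : ℤ) * B) | C) = 1

lemma rec_odd {A B C : ℕ} (hA : A % 2 = 1) (hB : B % 2 = 1) (hC : C % 2 = 1)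
    (hAB : A.Coprime B) (hAC : A.Coprime C) (hBC : B.Coprime C)
    (h : ∃ x y z : ZMod 8, (x = 1 ∨ y = 1 ∨ z = 1) ∧
      (A : ZMod 8) * x ^ 2 + B * y ^ 2 - C * z ^ 2 = 0) : Rec A B C := by
  rw [Rec, odd_formula hA hB hC hAB hAC hBC, E_mod A B, E_mod A C, E_mod B C, X4_mod]
  exact dec1 _ (odd_mem hA) _ (odd_mem hB) _ (odd_mem hC) (two_adic h)

lemma rec_even_left {A B C : ℕ} (hA : A % 2 = 1) (hB : B % 2 = 1) (hC : C % 2 = 1)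
    (hAB : A.Coprime B) (hAC : A.Coprime C) (hBC : B.Coprime C)
    (h : ∃ x y z : ZMod 8, (x = 1 ∨ y = 1 ∨ z = 1) ∧
      ((2 * A : ℕ) : ZMod 8) * x ^ 2 + B * y ^ 2 - C * z ^ 2 = 0) : Rec (2 * A) B C := by
  have e1 : (((2 * A : ℕ) : ℤ) * C) = 2 * (A * C) := by push_cast; ring
  have e2 : -(((2 * A : ℕ) : ℤ) * B) = 2 * (-(A * B)) := by push_cast; ring
  have h1 : ((B : ℤ) * C) % 2 = 1 := by
    rw [Int.mul_emod]; have : (B : ℤ) % 2 = 1 := by omega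
    have : (C : ℤ) % 2 = 1 := by omega
    simp [*]
  rw [Rec, e1, e2, jacobiSym.mul_right' _ (by norm_num) (by omega), j_at_two h1,
    jacobiSym.mul_left 2, jacobiSym.mul_left 2, j_two hB, j_two hC]
  have := odd_formula hA hB hC hAB hAC hBC
  have k := dec2 _ (odd_mem hA) _ (odd_mem hB) _ (odd_mem hC) (by
    have := two_adic h
    rwa [Nat.mul_mod, show 2 % 8 = 2 from rfl] at this)
  rw [← E_mod, ← E_mod, ← E_mod, ← X4_mod, ← X8_mod, ← X8_mod] at k
  rw [← this] at k
  linear_combination k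

lemma rec_even_right {A B C : ℕ} (hA : A % 2 = 1) (hB : B % 2 = 1) (hC : C % 2 = 1)
    (hAB : A.Coprime B) (hAC : A.Coprime C) (hBC : B.Coprime C)
    (h : ∃ x y z : ZMod 8, (x = 1 ∨ y = 1 ∨ z = 1) ∧
      (A : ZMod 8) * x ^ 2 + B * y ^ 2 - ((2 * C : ℕ) : ZMod 8) * z ^ 2 = 0) :
    Rec A B (2 * C) := by
  have e1 : ((A : ℤ) * (2 * C : ℕ)) = 2 * (A * C) := by push_cast; ring
  have e2 : ((B : ℤ) * (2 * C : ℕ)) = 2 * (B * C) := by push_cast; ring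
  have h1 : (-((A : ℤ) * B)) % 2 = 1 := by
    have : ((A : ℤ) * B) % 2 = 1 := by
      rw [Int.mul_emod]; have : (B : ℤ) % 2 = 1 := by omega
      have : (A : ℤ) % 2 = 1 := by omega
      simp [*]
    omega
  rw [Rec, e1, e2, jacobiSym.mul_right' _ (by norm_num) (by omega), j_at_two h1,
    jacobiSym.mul_left 2, jacobiSym.mul_left 2, j_two hA, j_two hB]
  have := odd_formula hA hB hC hAB hAC hBC
  have k := dec3 _ (odd_mem hA) _ (odd_mem hB) _ (odd_mem hC) (by
    have := two_adic h
    rwa [Nat.mul_mod 2, show 2 % 8 = 2 from rfl] at this)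
  rw [← E_mod, ← E_mod, ← E_mod, ← X4_mod, ← X8_mod, ← X8_mod] at k
  rw [← this] at k
  linear_combination k

lemma rec_swap {A B C : ℕ} (h : Rec A B C) : Rec B A C := by
  unfold Rec at *
  rw [mul_comm (B : ℤ) A]
  rw [← h]; ring

lemma rec_all {A B C : ℕ}
    (hAB : A.Coprime B) (hAC : A.Coprime C) (hBC : B.Coprime C)
    (hA4 : ¬ 4 ∣ A) (hB4 : ¬ 4 ∣ B) (hC4 : ¬ 4 ∣ C)
    (h : ∃ x y z : ZMod 8, (x = 1 ∨ y = 1 ∨ z = 1) ∧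
      (A : ZMod 8) * x ^ 2 + B * y ^ 2 - C * z ^ 2 = 0) : Rec A B C := by
  have two : ∀ {m n : ℕ}, m.Coprime n → ¬ (m % 2 = 0 ∧ n % 2 = 0) := by
    rintro m n h ⟨h1, h2⟩
    have := Nat.dvd_gcd (Nat.dvd_of_mod_eq_zero h1) (Nat.dvd_of_mod_eq_zero h2)
    rw [h] at this
    omega
  have t1 := two hAB
  have t2 := two hAC
  have t3 := two hBC
  by_cases hA : A % 2 = 0
  · obtain ⟨A, rfl⟩ := Nat.dvd_of_mod_eq_zero hA
    exact rec_even_left (by omega) (by omega) (by omega) hAB.coprime_mul_left hAC.coprime_mul_left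
      hBC h
  by_cases hB : B % 2 = 0
  · obtain ⟨B, rfl⟩ := Nat.dvd_of_mod_eq_zero hB
    apply rec_swap
    refine rec_even_left (by omega) (by omega) (by omega) hAB.symm.coprime_mul_left
      hBC.coprime_mul_left hAC ?_
    obtain ⟨x, y, z, h0, h⟩ := h
    exact ⟨y, x, z, by tauto, by linear_combination h⟩
  by_cases hC : C % 2 = 0
  · obtain ⟨C, rfl⟩ := Nat.dvd_of_mod_eq_zero hC
    exact rec_even_right (by omega) (by omega) (by omega) hAB hAC.coprime_mul_left_right
      hBC.coprime_mul_left_right h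
  exact rec_odd (by omega) (by omega) (by omega) hAB hAC hBC h

end HM


namespace HM
open NumberTheorySymbols ZMod

/-- The product of the local symbols at the primes dividing the coefficients. -/
def PJ (a b c : ℤ) : ℤ :=
  J(-(b * c) | a.natAbs) * J(-(c * a) | b.natAbs) * J(-(a * b) | c.natAbs)

lemma PJ_rot (a b c : ℤ) : PJ b c a = PJ a b c := by unfold PJ; ring

lemma PJ_neg (a b c : ℤ) : PJ (-a) (-b) (-c) = PJ a b c := by
  unfold PJ; simp only [neg_mul_neg, Int.natAbs_neg]

/-- Pairwise coprime coefficients, none divisible by 4. -/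
def Good (a b c : ℤ) : Prop := a.natAbs.Coprime b.natAbs ∧ b.natAbs.Coprime c.natAbs ∧
  c.natAbs.Coprime a.natAbs ∧ ¬ 4 ∣ a.natAbs ∧ ¬ 4 ∣ b.natAbs ∧ ¬ 4 ∣ c.natAbs

lemma Good.rot {a b c : ℤ} (h : Good a b c) : Good b c a := by unfold Good at *; tauto
lemma Good.neg {a b c : ℤ} (h : Good a b c) : Good (-a) (-b) (-c) := by
  unfold Good at *; simpa using h

lemma PJ_aux {a b c : ℤ} (ha : 0 < a) (hb : 0 < b) (hc : c < 0) (hg : Good a b c)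
    (h2 : Iso3 ℚ_[2] a b c) : PJ a b c = 1 := by
  obtain ⟨A, rfl⟩ := Int.eq_ofNat_of_zero_le ha.le
  obtain ⟨B, rfl⟩ := Int.eq_ofNat_of_zero_le hb.le
  obtain ⟨C, hC⟩ := Int.eq_ofNat_of_zero_le (a := -c) (by omega)
  obtain rfl : c = -C := by omega
  obtain ⟨h1, h3, h4, h5, h6, h7⟩ := hg
  simp only [Int.natAbs_natCast, Int.natAbs_neg] at *
  have := rec_all h1 h4.symm h3 h5 h6 h7 (by
    obtain ⟨x, y, z, h0, h⟩ := prim_two h2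
    refine ⟨x, y, z, h0, ?_⟩
    push_cast at h
    linear_combination h)
  unfold Rec at this
  unfold PJ
  simp only [Int.natAbs_natCast, Int.natAbs_neg]
  rw [← this]
  congr 3 <;> ring

lemma PJ_pos {a b c : ℤ} (ha : 0 < a) (hb : b ≠ 0) (hc : c ≠ 0)
    (hg : Good a b c) (hR : Iso3 ℝ a b c) (h2 : Iso3 ℚ_[2] a b c) : PJ a b c = 1 := by
  rcases lt_or_gt_of_ne hb with hb | hb <;> rcases lt_or_gt_of_ne hc with hc | hc
  · rw [← PJ_neg, ← PJ_rot]
    exact PJ_aux (by omega) (by omega) (by omega) hg.neg.rot h2.neg.rot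
  · rw [← PJ_rot, ← PJ_rot]
    exact PJ_aux (by omega) (by omega) (by omega) hg.rot.rot h2.rot.rot
  · exact PJ_aux (by omega) (by omega) (by omega) hg h2
  · exact absurd hR (real_iso3_not_pos ha hb hc)

lemma PJ_one {a b c : ℤ} (ha : a ≠ 0) (hb : b ≠ 0) (hc : c ≠ 0)
    (hg : Good a b c) (hR : Iso3 ℝ a b c) (h2 : Iso3 ℚ_[2] a b c) : PJ a b c = 1 := by
  rcases lt_or_gt_of_ne ha with ha | ha
  · rw [← PJ_neg]
    exact PJ_pos (by omega) (by omega) (by omega) hg.neg hR.neg h2.neg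
  · exact PJ_pos ha hb hc hg hR h2

lemma sqf_dvd {a b c : ℤ} (h : Squarefree (a * b * c)) {p : ℕ} (hp : p.Prime) (hpa : (p : ℤ) ∣ a) :
    ¬ (p : ℤ) ^ 2 ∣ a ∧ ¬ (p : ℤ) ∣ b ∧ ¬ (p : ℤ) ∣ c := by
  have hu : ¬ IsUnit (p : ℤ) := by
    rw [Int.isUnit_iff_natAbs_eq]; simpa using hp.one_lt.ne'
  refine ⟨fun h1 => hu (h p ?_), fun h1 => hu (h p ?_), fun h1 => hu (h p ?_)⟩
  · rw [← sq, mul_assoc]; exact Dvd.dvd.mul_right h1 _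
  · exact Dvd.dvd.mul_right (mul_dvd_mul hpa h1) _
  · exact mul_dvd_mul (Dvd.dvd.mul_right hpa _) h1

lemma sqf_rot {a b c : ℤ} (h : Squarefree (a * b * c)) : Squarefree (b * c * a) := by
  rwa [show b * c * a = a * b * c by ring]

lemma good_of_sqf {a b c : ℤ} (h : Squarefree (a * b * c)) : Good a b c := by
  have key : ∀ {a b c : ℤ}, Squarefree (a * b * c) →
      a.natAbs.Coprime b.natAbs ∧ ¬ 4 ∣ a.natAbs := by
    intro a b c h
    constructor
    · apply Nat.Coprime.symm
      apply Nat.coprime_of_dvd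
      intro p hp h1 h2
      exact (sqf_dvd h hp (Int.natCast_dvd.mpr h2)).2.1 (Int.natCast_dvd.mpr h1)
    · intro h4
      have h4' : ((2 : ℕ) : ℤ) ^ 2 ∣ a := by
        have := Int.natCast_dvd.mpr h4
        norm_num at *; exact this
      exact (sqf_dvd h Nat.prime_two (dvd_trans (dvd_pow_self _ (by norm_num)) h4')).1 h4'
  have h1 := key h
  have h2 := key (sqf_rot h)
  have h3 := key (sqf_rot (sqf_rot h))
  unfold Good
  tauto

lemma jac_part {a b c : ℤ} {q : ℕ} (h : Squarefree (a * b * c)) (m : ℕ) (hm : m ≠ 0)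
    (hma : m ∣ a.natAbs) (hqm : ¬ q ∣ m)
    (hp : ∀ (p : ℕ) [Fact p.Prime], p ≠ q → Iso3 ℚ_[p] a b c) : J(-(b * c) | m) = 1 := by
  apply jac_one _ _ hm
  intro p hpp hpm
  have : Fact p.Prime := ⟨hpp⟩
  have hpa : (p : ℤ) ∣ a := Int.natCast_dvd.mpr (hpm.trans hma)
  obtain ⟨h1, h2, h3⟩ := sqf_dvd h hpp hpa
  refine ⟨isSquare_of_iso3 hpa h1 (hp p ?_), ?_⟩
  · rintro rfl; exact hqm hpm
  · rw [dvd_neg, (Nat.prime_iff_prime_int.mp hpp).dvd_mul]; tauto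

lemma at_q {a b c : ℤ} {q : ℕ} [hq : Fact q.Prime] (hq2 : q ≠ 2) (ha : a ≠ 0) (hb : b ≠ 0)
    (hc : c ≠ 0) (h : Squarefree (a * b * c)) (hR : Iso3 ℝ a b c)
    (hp : ∀ (p : ℕ) [Fact p.Prime], p ≠ q → Iso3 ℚ_[p] a b c) (hqa : (q : ℤ) ∣ a) :
    Iso3 ℚ_[q] a b c := by
  obtain ⟨h1, h2, h3⟩ := sqf_dvd h hq.out hqa
  have hPJ := PJ_one ha hb hc (good_of_sqf h) hR (hp 2 hq2.symm)
  unfold PJ at hPJ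
  rw [jac_part (q := q) (sqf_rot h) b.natAbs (by simpa using hb) dvd_rfl
      (by rwa [← Int.natCast_dvd]) (fun p _ hpq => (hp p hpq).rot),
    jac_part (q := q) (sqf_rot (sqf_rot h)) c.natAbs (by simpa using hc) dvd_rfl
      (by rwa [← Int.natCast_dvd]) (fun p _ hpq => (hp p hpq).rot.rot), mul_one, mul_one] at hPJ
  obtain ⟨m, hm⟩ := Int.natCast_dvd.mp hqa
  have hm0 : m ≠ 0 := by rintro rfl; simp at hm; exact ha hm
  rw [hm, jacobiSym.mul_right' _ hq.out.ne_zero hm0, jac_part (q := q) h m hm0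
    (by rw [hm]; exact dvd_mul_left _ _) ?_ hp, mul_one] at hPJ
  · exact iso3_sqmod hq2 h2 h3 (isSquare_of_jacobiSym_eq_one hPJ)
  · rintro ⟨k, rfl⟩
    apply h1
    have : q ^ 2 ∣ a.natAbs := ⟨k, by rw [hm]; ring⟩
    exact_mod_cast Int.natCast_dvd.mpr this

/-- Ternary Hasse principle with an exceptional odd prime. -/
def P3 (q : ℕ) (a b c : ℤ) : Prop := Iso3 ℝ a b c →
  (∀ (p : ℕ) [Fact p.Prime], p ≠ q → Iso3 ℚ_[p] a b c) → Iso3 ℚ a b c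

lemma P3_sqf {a b c : ℤ} {q : ℕ} [hq : Fact q.Prime] (hq2 : q ≠ 2) (ha : a ≠ 0) (hb : b ≠ 0)
    (hc : c ≠ 0) (h : Squarefree (a * b * c)) : P3 q a b c := by
  intro hR hp
  apply ternary ha hb hc hR
  intro p _
  by_cases hpq : p = q
  · subst hpq
    by_cases hqa : (p : ℤ) ∣ a
    · exact at_q hq2 ha hb hc h hR hp hqa
    by_cases hqb : (p : ℤ) ∣ b
    · exact (at_q hq2 hb hc ha (sqf_rot h) hR.rot (fun p _ hpq => (hp p hpq).rot) hqb).rot.rot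
    by_cases hqc : (p : ℤ) ∣ c
    · exact (at_q hq2 hc ha hb (sqf_rot (sqf_rot h)) hR.rot.rot
        (fun p _ hpq => (hp p hpq).rot.rot) hqc).rot
    exact iso3_unit hq2 hqa hqb hqc
  · exact hp p hpq

lemma P3.congr {q : ℕ} {a b c a' b' c' : ℤ}
    (h : ∀ (K : Type) [Field K] [CharZero K], Iso3 K a b c ↔ Iso3 K a' b' c')
    (H : P3 q a b c) : P3 q a' b' c' := by
  intro hR hp
  rw [← h]
  exact H ((h _).mpr hR) (fun p _ hpq => (h _).mpr (hp p hpq))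

lemma P3.rot {q : ℕ} {a b c : ℤ} (H : P3 q a b c) : P3 q b c a :=
  H.congr (fun _ _ _ => ⟨fun h => h.rot, fun h => h.rot.rot⟩)

/-- One reduction step, when `p ∣ a` and `p ^ 2 ∣ a * b * c`. -/
lemma step {a b c : ℤ} {q p : ℕ} (hp : p.Prime) (ha : a ≠ 0) (hb : b ≠ 0) (hc : c ≠ 0)
    (hpa : (p : ℤ) ∣ a) (h : (p : ℤ) * p ∣ a * b * c)
    (ih : ∀ a' b' c' : ℤ, a' ≠ 0 → b' ≠ 0 → c' ≠ 0 →
      (a' * b' * c').natAbs < (a * b * c).natAbs → P3 q a' b' c') : P3 q a b c := by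
  have hpp := Nat.prime_iff_prime_int.mp hp
  have hp0 : (p : ℤ) ≠ 0 := hpp.ne_zero
  have lt : ∀ x : ℤ, x ≠ 0 → x.natAbs < (p * x).natAbs := by
    intro x hx
    rw [Int.natAbs_mul, Int.natAbs_natCast]
    have : x.natAbs ≠ 0 := by simpa using hx
    have := hp.two_le
    nlinarith [Nat.pos_of_ne_zero ‹x.natAbs ≠ 0›]
  obtain ⟨a, rfl⟩ := hpa
  have ha' : a ≠ 0 := by rintro rfl; simp at ha
  have h' : (p : ℤ) ∣ a * b * c := by
    rw [show (p : ℤ) * a * b * c = p * (a * b * c) by ring] at h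
    exact (mul_dvd_mul_iff_left hp0).mp h
  rcases hpp.dvd_or_dvd h' with h' | ⟨c, rfl⟩
  · rcases hpp.dvd_or_dvd h' with ⟨a, rfl⟩ | ⟨b, rfl⟩
    · have ha2 : a ≠ 0 := by rintro rfl; simp at ha
      refine (ih a b c ha2 hb hc ?_).congr (fun K _ _ => ?_)
      · refine (lt (a * b * c) (by positivity)).trans ?_
        have e := lt (p * (a * b * c)) (by positivity)
        ring_nf at e ⊢
        exact e
      · rw [← iso3_sq hp0, show (p : ℤ) ^ 2 * a = p * (p * a) by ring]
    · have hb' : b ≠ 0 := by rintro rfl; simp at hb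
      refine (ih a b (p * c) ha' hb' (by positivity) ?_).congr (fun K _ _ => (iso3_mul hp0).symm)
      have e := lt (a * b * (p * c)) (by positivity)
      ring_nf at e ⊢
      exact e
  · have hc' : c ≠ 0 := by rintro rfl; simp at hc
    have : P3 q c a (p * b) := by
      apply ih c a (p * b) hc' ha' (by positivity)
      have e := lt (c * a * (p * b)) (by positivity)
      ring_nf at e ⊢
      exact e
    exact (this.congr (fun K _ _ => (iso3_mul hp0).symm)).rot

lemma P3_aux (q : ℕ) [hq : Fact q.Prime] (hq2 : q ≠ 2) (N : ℕ) : ∀ a b c : ℤ, a ≠ 0 → b ≠ 0 →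
    c ≠ 0 → (a * b * c).natAbs ≤ N → P3 q a b c := by
  induction N with
  | zero =>
    intro a b c ha hb hc h
    have : a * b * c ≠ 0 := by positivity
    omega
  | succ N ih =>
    intro a b c ha hb hc hN
    by_cases hs : Squarefree (a * b * c)
    · exact P3_sqf hq2 ha hb hc hs
    rw [← Int.squarefree_natAbs, Nat.squarefree_iff_prime_squarefree] at hs
    push Not at hs
    obtain ⟨p, hp, hd⟩ := hs
    have hd' : (p : ℤ) * p ∣ a * b * c := by exact_mod_cast Int.natCast_dvd.mpr hd
    have hpp := Nat.prime_iff_prime_int.mp hp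
    have r1 : b * c * a = a * b * c := by ring
    have r2 : c * a * b = a * b * c := by ring
    rcases hpp.dvd_or_dvd (dvd_of_mul_left_dvd hd') with h | h
    · rcases hpp.dvd_or_dvd h with h | h
      · exact step hp ha hb hc h hd' (fun a' b' c' h1 h2 h3 h4 => ih a' b' c' h1 h2 h3 (by omega))
      · refine P3.rot (P3.rot (step hp hb hc ha h (by rwa [r1]) ?_))
        exact (fun a' b' c' h1 h2 h3 h4 => ih a' b' c' h1 h2 h3 (by rw [r1] at h4; omega))
    · refine P3.rot (step hp hc ha hb h (by rwa [r2]) ?_)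
      exact (fun a' b' c' h1 h2 h3 h4 => ih a' b' c' h1 h2 h3 (by rw [r2] at h4; omega))

theorem ternary_except {q : ℕ} [hq : Fact q.Prime] (hq2 : q ≠ 2) {a b c : ℤ} (ha : a ≠ 0)
    (hb : b ≠ 0) (hc : c ≠ 0) (hR : Iso3 ℝ a b c)
    (hp : ∀ (p : ℕ) [Fact p.Prime], p ≠ q → Iso3 ℚ_[p] a b c) : Iso3 ℚ a b c :=
  P3_aux q hq2 _ a b c ha hb hc le_rfl hR hp

end HM


namespace HM

/-- Approximation, using Dirichlet's theorem. -/
lemma approx (S : Finset ℕ) (hS : ∀ p ∈ S, p.Prime) {r : ℝ} (hr : r ≠ 0)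
    (y : ∀ (p : ℕ) [Fact p.Prime], ℚ_[p]) (hy : ∀ (p : ℕ) [Fact p.Prime], y p ≠ 0) :
    ∃ (x : ℤ) (q : ℕ), q.Prime ∧ q ∉ S ∧ x ≠ 0 ∧ (∃ s : ℝ, s ≠ 0 ∧ r = x * s ^ 2) ∧
      (∀ (p : ℕ) [Fact p.Prime], p ∈ S → ∃ s : ℚ_[p], s ≠ 0 ∧ y p = x * s ^ 2) ∧
      ∀ p : ℕ, p.Prime → p ∉ S → p ≠ q → ¬ (p : ℤ) ∣ x := by
  classical
  obtain ⟨ε, hε, hεr⟩ : ∃ ε : ℤ, (ε = 1 ∨ ε = -1) ∧ 0 < r * ε := by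
    rcases lt_or_gt_of_ne hr with h | h
    · exact ⟨-1, Or.inr rfl, by push_cast; linarith⟩
    · exact ⟨1, Or.inl rfl, by push_cast; linarith⟩
  have hεu : IsUnit ε := Int.isUnit_iff.mpr hε
  let e : ℕ → ℕ := fun p => if h : p.Prime then
    (@Padic.valuation p ⟨h⟩ (@y p ⟨h⟩) % 2).toNat else 0
  let P : ℕ := ∏ p ∈ S, p ^ e p
  have hP0 : 0 < P := Finset.prod_pos (fun p hp => pow_pos (hS p hp).pos _)
  have hPd : ∀ T : Finset ℕ, (∀ p ∈ T, p.Prime) → ∀ p : ℕ, p.Prime → p ∉ T →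
      ¬ p ∣ ∏ l ∈ T, l ^ e l := by
    intro T hT p hp hpT hd
    obtain ⟨l, hl, hd⟩ := (Prime.dvd_finsetProd_iff hp.prime _).mp hd
    have := (Nat.prime_dvd_prime_iff_eq hp (hT l hl)).mp (hp.dvd_of_dvd_pow hd)
    exact hpT (this ▸ hl)
  have hx0 : (ε * P : ℤ) ≠ 0 := mul_ne_zero hεu.ne_zero (by exact_mod_cast hP0.ne')
  have key : ∀ p : ℕ, ∃ m : ℕ, p ∈ S → ¬ p ∣ m ∧ ∀ (_ : Fact p.Prime) (n : ℕ), n ≡ m [MOD p ^ 3] →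
      ∃ s : ℚ_[p], s ≠ 0 ∧ y p = ((ε * P * n : ℤ) : ℚ_[p]) * s ^ 2 := by
    intro p
    by_cases hpS : p ∈ S
    swap
    · exact ⟨0, fun h => absurd h hpS⟩
    have hp : Fact p.Prime := ⟨hS p hpS⟩
    have hx0' : ((ε * P : ℤ) : ℚ_[p]) ≠ 0 := by exact_mod_cast hx0
    have hv : ∃ k : ℤ, (y p * ((ε * P : ℤ) : ℚ_[p])⁻¹).valuation = 2 * k := by
      rw [Padic.valuation_mul (hy p) (inv_ne_zero hx0'), Padic.valuation_inv,
        Padic.valuation_intCast]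
      have h1 : padicValInt p (ε * P) = e p := by
        rw [padicValInt, Int.natAbs_mul, Int.isUnit_iff_natAbs_eq.mp hεu, one_mul,
          Int.natAbs_natCast]
        change padicValNat p (∏ p ∈ S, p ^ e p) = e p
        rw [← Finset.mul_prod_erase S _ hpS]
        have h2 := hPd (S.erase p) (fun l hl => hS l (Finset.mem_of_mem_erase hl)) p hp.out
          (Finset.notMem_erase p S)
        rw [padicValNat.mul (pow_ne_zero _ hp.out.ne_zero) (by rintro h; rw [h] at h2; simp at h2),
          padicValNat.eq_zero_of_not_dvd h2, padicValNat.prime_pow, add_zero]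
      have h3 : (e p : ℤ) = (y p).valuation % 2 := by
        simp only [e, dif_pos hp.out]
        exact Int.toNat_of_nonneg (Int.emod_nonneg _ (by norm_num))
      rw [h1, h3]
      exact ⟨(y p).valuation / 2, by omega⟩
    obtain ⟨k, hk⟩ := hv
    obtain ⟨m, hm, H⟩ := even_val (mul_ne_zero (hy p) (inv_ne_zero hx0')) hk
    refine ⟨m, fun _ => ⟨hm, fun _ n hn => ?_⟩⟩
    obtain ⟨s, hs, h⟩ := H n hn
    refine ⟨s, hs, ?_⟩
    rw [← div_eq_mul_inv, div_eq_iff hx0'] at h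
    rw [h]; push_cast; ring
  choose m hm using key
  have hcop : ((S : Set ℕ)).Pairwise (Function.onFun Nat.Coprime (fun p => p ^ 3)) := by
    intro p hp l hl hne
    exact Nat.Coprime.pow _ _ ((Nat.coprime_primes (hS p hp) (hS l hl)).mpr hne)
  obtain ⟨k, hk⟩ := Nat.chineseRemainderOfFinset m (fun p => p ^ 3) S
    (fun p hp => pow_ne_zero _ (hS p hp).ne_zero) hcop
  have hkc : k.Coprime (∏ p ∈ S, p ^ 3) := by
    apply Nat.Coprime.prod_right
    intro p hp
    apply Nat.Coprime.pow_right
    rw [Nat.coprime_comm, (hS p hp).coprime_iff_not_dvd]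
    rw [((hk p hp).of_dvd (dvd_pow_self p (by norm_num))).dvd_iff dvd_rfl]
    exact (hm p hp).1
  obtain ⟨q, hqgt, hq, hqk⟩ := Nat.forall_exists_prime_gt_and_modEq (∑ p ∈ S, p)
    (Finset.prod_ne_zero_iff.mpr (fun p hp => pow_ne_zero 3 (hS p hp).ne_zero)) hkc
  have hqS : q ∉ S := fun h => by
    have := Finset.single_le_sum (f := fun p : ℕ => p) (fun _ _ => Nat.zero_le _) h
    omega
  refine ⟨ε * P * q, q, hq, hqS, mul_ne_zero hx0 (by exact_mod_cast hq.ne_zero), ?_, ?_, ?_⟩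
  · have hPR : (0 : ℝ) < P := by exact_mod_cast hP0
    have hqR : (0 : ℝ) < q := by exact_mod_cast hq.pos
    have hε2 : (ε : ℝ) ^ 2 = 1 := by rcases hε with rfl | rfl <;> norm_num
    have hpos : 0 < r * ε / (P * q) := by positivity
    refine ⟨√(r * ε / (P * q)), (Real.sqrt_pos.mpr hpos).ne', ?_⟩
    rw [Real.sq_sqrt hpos.le]
    push_cast
    field_simp
    rw [hε2]
  · intro p hp hpS
    refine (hm p hpS).2 hp q ?_
    exact (hqk.of_dvd (Finset.dvd_prod_of_mem (fun p => p ^ 3) hpS)).trans (hk p hpS)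
  · intro p hp hpS hpq hd
    have : p ∣ (ε * P * q : ℤ).natAbs := Int.natCast_dvd.mp hd
    rw [Int.natAbs_mul, Int.natAbs_mul, Int.isUnit_iff_natAbs_eq.mp hεu, one_mul,
          Int.natAbs_natCast, Int.natAbs_natCast] at this
    rcases hp.dvd_mul.mp this with h | h
    · exact hPd S hS p hp hpS h
    · exact hpq ((Nat.prime_dvd_prime_iff_eq hp hq).mp h)

lemma iso2 {K : Type} [Field K] [CharZero K] {c : Fin 2 → ℤ} (hc : ∀ i, c i ≠ 0) :
    Iso K c ↔ IsSquare ((-(c 0 * c 1) : ℤ) : K) := by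
  have h0 : (c 0 : K) ≠ 0 := by exact_mod_cast hc 0
  have h1 : (c 1 : K) ≠ 0 := by exact_mod_cast hc 1
  constructor
  · rintro ⟨x, hx, h⟩
    rw [Fin.sum_univ_two] at h
    have hx1 : x 1 ≠ 0 := by
      intro h'
      apply hx
      have : x 0 = 0 := by simpa [h', h0] using h
      ext i
      fin_cases i
      · exact this
      · exact h'
    refine ⟨c 0 * x 0 / x 1, ?_⟩
    field_simp
    push_cast
    linear_combination -h * c 0
  · rintro ⟨t, ht⟩
    refine ⟨![t, c 0], fun h => h0 (by simpa using congrFun h 1), ?_⟩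
    rw [Fin.sum_univ_two]
    push_cast at ht
    simp only [Matrix.cons_val_zero, Matrix.cons_val_one]
    linear_combination -c 0 * ht

lemma hasse2 {c : Fin 2 → ℤ} (hc : ∀ i, c i ≠ 0) (hR : Iso ℝ c)
    (hp : ∀ (p : ℕ) [Fact p.Prime], Iso ℚ_[p] c) : Iso ℚ c := by
  rw [iso2 hc] at hR ⊢
  have hp : ∀ (p : ℕ) [Fact p.Prime], IsSquare ((-(c 0 * c 1) : ℤ) : ℚ_[p]) :=
    fun p _ => (iso2 hc).mp (hp p)
  have hne : -(c 0 * c 1) ≠ 0 := by simp [hc]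
  generalize -(c 0 * c 1) = N at *
  have hN : 0 ≤ N := by exact_mod_cast hR.nonneg
  lift N to ℕ using hN
  obtain ⟨a, b, hab, ha⟩ := Nat.sq_mul_squarefree N
  have hN0 : N ≠ 0 := by exact_mod_cast hne
  have hb0 : b ≠ 0 := by rintro rfl; simp at hab; omega
  have ha1 : a = 1 := by
    by_contra ha1
    obtain ⟨p, hpp, k, rfl⟩ := Nat.exists_prime_and_dvd ha1
    have : Fact p.Prime := ⟨hpp⟩
    have hk : ¬ p ∣ k := by
      rintro ⟨l, rfl⟩
      exact hpp.one_lt.ne' (Nat.isUnit_iff.mp (ha p ⟨l, by ring⟩))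
    have hk0 : k ≠ 0 := by rintro rfl; simp at hk
    obtain ⟨t, ht⟩ := hp p
    have h1 := congrArg Padic.valuation ht
    rw [← pow_two, Padic.valuation_pow, Padic.valuation_intCast, ← hab] at h1
    rw [padicValInt, Int.natAbs_natCast, padicValNat.mul (by positivity) (by positivity [hpp.pos]),
      padicValNat.pow, padicValNat.mul hpp.ne_zero hk0, padicValNat.self hpp.one_lt,
      padicValNat.eq_zero_of_not_dvd hk] at h1
    push_cast at h1
    omega
  subst ha1
  exact ⟨b, by rw [← hab]; push_cast; ring⟩

lemma hasse_step {m : ℕ} {a b : ℤ} {g : Fin (m + 2) → ℤ} (ha : a ≠ 0) (hb : b ≠ 0)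
    (hg : ∀ i, g i ≠ 0)
    (ih : ∀ (x : ℤ) (q : ℕ) [Fact q.Prime], q ≠ 2 → x ≠ 0 → (∀ i, ¬ (q : ℤ) ∣ g i) →
      Iso ℝ (Fin.cons x g : Fin (m + 3) → ℤ) →
      (∀ (p : ℕ) [Fact p.Prime], p ≠ q → Iso ℚ_[p] (Fin.cons x g : Fin (m + 3) → ℤ)) →
      Iso ℚ (Fin.cons x g : Fin (m + 3) → ℤ))
    (hR : Iso ℝ (Fin.cons a (Fin.cons b g) : Fin (m + 4) → ℤ))
    (hp : ∀ (p : ℕ) [Fact p.Prime], Iso ℚ_[p] (Fin.cons a (Fin.cons b g) : Fin (m + 4) → ℤ)) :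
    Iso ℚ (Fin.cons a (Fin.cons b g) : Fin (m + 4) → ℤ) := by
  obtain ⟨r, hr, hr1, hr2⟩ := common ha hb hg hR
  have hp' := fun (p : ℕ) [Fact p.Prime] => common ha hb hg (hp p)
  choose y hy0 hy1 hy2 using hp'
  have hD : 2 * a * b * ∏ i, g i ≠ 0 :=
    mul_ne_zero (by positivity) (Finset.prod_ne_zero_iff.mpr (fun i _ => hg i))
  let S := (2 * a * b * ∏ i, g i).natAbs.primeFactors
  have hS : ∀ p : ℕ, p.Prime → p ∉ S → p ≠ 2 ∧ ¬ (p : ℤ) ∣ a ∧ ¬ (p : ℤ) ∣ b ∧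
      ∀ i, ¬ (p : ℤ) ∣ g i := by
    intro p hpp hpS
    have hpS : ¬ (p : ℤ) ∣ 2 * a * b * ∏ i, g i := by
      intro h
      exact hpS (Nat.mem_primeFactors.mpr ⟨hpp, Int.natCast_dvd.mp h, by simpa using hD⟩)
    refine ⟨?_, fun h => hpS ?_, fun h => hpS ?_, fun i h => hpS ?_⟩
    · rintro rfl
      exact hpS ⟨a * b * ∏ i, g i, by push_cast; ring⟩
    · exact ((h.mul_left 2).mul_right b).mul_right _
    · exact (h.mul_left _).mul_right _
    · exact (h.trans (Finset.dvd_prod_of_mem g (Finset.mem_univ i))).mul_left _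
  obtain ⟨x, q, hq, hqS, hx, ⟨s, hs, hrs⟩, hyS, hxd⟩ := approx S
    (fun p h => Nat.prime_of_mem_primeFactors h) hr (fun p _ => y p) (fun p _ => hy0 p)
  have : Fact q.Prime := ⟨hq⟩
  obtain ⟨hq2, hqa, hqb, hqg⟩ := hS q hq hqS
  apply iso_combine hx
  · apply ternary_except hq2 ha hb (neg_ne_zero.mpr hx) (iso3_of_rep hs hrs hr1)
    intro p hpp hpq
    by_cases hpS : p ∈ S
    · obtain ⟨t, ht, hyt⟩ := hyS p hpS
      exact iso3_of_rep ht hyt (hy1 p)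
    · obtain ⟨h2, h3, h4, h5⟩ := hS p hpp.out hpS
      exact iso3_unit h2 h3 h4 (by rw [dvd_neg]; exact hxd p hpp.out hpS hpq)
  · apply ih x q hq2 hx hqg (iso_of_rep hs hrs hr2)
    intro p hpp hpq
    by_cases hpS : p ∈ S
    · obtain ⟨t, ht, hyt⟩ := hyS p hpS
      exact iso_of_rep ht hyt (hy2 p)
    · obtain ⟨h2, h3, h4, h5⟩ := hS p hpp.out hpS
      apply iso_of_iso3
      exact iso3_unit h2 (hxd p hpp.out hpS hpq) (h5 0) (h5 1)

lemma cons_ne {n : ℕ} {x : ℤ} {g : Fin n → ℤ} (hx : x ≠ 0) (hg : ∀ i, g i ≠ 0) :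
    ∀ i, (Fin.cons x g : Fin (n + 1) → ℤ) i ≠ 0 := by
  intro i
  refine Fin.cases ?_ (fun j => ?_) i
  · simpa using hx
  · simpa using hg j

lemma cons_cons {n : ℕ} (c : Fin (n + 2) → ℤ) :
    c = Fin.cons (c 0) (Fin.cons (c 1) (fun i => c i.succ.succ)) := by
  ext i
  refine Fin.cases ?_ (fun j => ?_) i
  · simp
  · refine Fin.cases ?_ (fun j => ?_) j <;> simp

theorem hasse_ge3 (n : ℕ) : ∀ c : Fin (n + 3) → ℤ, (∀ i, c i ≠ 0) → Iso ℝ c →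
    (∀ (p : ℕ) [Fact p.Prime], Iso ℚ_[p] c) → Iso ℚ c := by
  induction n with
  | zero =>
    intro c hc hR hp
    exact iso_of_iso3 (ternary (hc _) (hc _) (hc _) (iso3_of_iso hR)
      (fun p _ => iso3_of_iso (hp p)))
  | succ n ih =>
    intro c hc hR hp
    have hcc := cons_cons c
    have hg : ∀ i : Fin (n + 2), (fun i => c i.succ.succ) i ≠ 0 := fun i => hc _
    rw [hcc] at hR ⊢
    have hp : ∀ (p : ℕ) [Fact p.Prime], Iso ℚ_[p] (Fin.cons (c 0) (Fin.cons (c 1)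
      (fun i => c i.succ.succ)) : Fin (n + 4) → ℤ) := fun p _ => hcc ▸ hp p
    refine hasse_step (hc _) (hc _) hg ?_ hR hp
    intro x q _ hq2 hx hqg hR' hp'
    cases n with
    | zero =>
      exact iso_of_iso3 (ternary_except hq2 (cons_ne hx hg _) (cons_ne hx hg _) (cons_ne hx hg _)
        (iso3_of_iso hR') (fun p _ hpq => iso3_of_iso (hp' p hpq)))
    | succ n =>
      apply ih _ (cons_ne hx hg) hR'
      intro p _
      by_cases hpq : p = q
      · subst hpq
        exact iso_of_tail (iso_of_iso3 (iso3_unit hq2 (hqg _) (hqg _) (hqg _)))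
      · exact hp' p hpq

theorem hasse : ∀ (n : ℕ) (c : Fin n → ℤ), (∀ i, c i ≠ 0) → Iso ℝ c →
    (∀ (p : ℕ) [Fact p.Prime], Iso ℚ_[p] c) → Iso ℚ c
  | 0, c, _, ⟨x, hx, _⟩, _ => absurd (Subsingleton.elim _ _) hx
  | 1, c, hc, ⟨x, hx, h⟩, _ => by
    exfalso
    apply hx
    have h0 : (c 0 : ℝ) ≠ 0 := by exact_mod_cast hc 0
    ext i
    fin_cases i
    simpa [h0] using h
  | 2, _, hc, hR, hp => hasse2 hc hR hp
  | n + 3, c, hc, hR, hp => hasse_ge3 n c hc hR hp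

end HM


namespace HM
open Matrix

lemma exists_diag {n : ℕ} (A : Matrix (Fin n) (Fin n) ℚ) (hsym : Aᵀ = A) :
    ∃ (P : Matrix (Fin n) (Fin n) ℚ) (w : Fin n → ℚ), IsUnit P.det ∧
      Pᵀ * A * P = Matrix.diagonal w := by
  have : Invertible (2 : ℚ) := invertibleOfNonzero (by norm_num)
  have hB : LinearMap.IsSymm (Matrix.toBilin' A) := by
    refine ⟨fun x y => ?_⟩
    rw [Matrix.toBilin'_apply', Matrix.toBilin'_apply', RingHom.id_apply, Matrix.dotProduct_mulVec,
      ← Matrix.mulVec_transpose, hsym, dotProduct_comm]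
  obtain ⟨v, hv⟩ := LinearMap.BilinForm.exists_orthogonal_basis hB
  let e : Fin (Module.finrank ℚ (Fin n → ℚ)) ≃ Fin n := finCongr (by simp)
  let v' := v.reindex e
  let P : Matrix (Fin n) (Fin n) ℚ := (Pi.basisFun ℚ (Fin n)).toMatrix v'
  refine ⟨P, fun i => Matrix.toBilin' A (v' i) (v' i), ?_, ?_⟩
  · rw [← Matrix.isUnit_iff_isUnit_det]
    have := Module.Basis.invertibleToMatrix (Pi.basisFun ℚ (Fin n)) v'
    exact isUnit_of_invertible P
  · have hPv : ∀ i, P.col i = v' i := by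
      intro i; ext j; simp [P, Module.Basis.toMatrix_apply]
    ext i j
    have h1 : (Pᵀ * A * P) i j = Matrix.toBilin' A (v' i) (v' j) := by
      rw [Matrix.toBilin'_apply', ← hPv, ← hPv, Matrix.mul_assoc]
      simp only [Matrix.mul_apply, dotProduct, mulVec, Matrix.transpose_apply, Matrix.col_apply]
    rw [h1, Matrix.diagonal_apply]
    split_ifs with hij
    · subst hij; rfl
    · simp only [v', Module.Basis.reindex_apply]
      exact hv (fun h => hij (e.symm.injective h))

lemma iso_congr {K : Type} [Field K] {n : ℕ} {A P D : Matrix (Fin n) (Fin n) K}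
    (hP : IsUnit P.det) (h : Pᵀ * A * P = D) :
    (∃ x : Fin n → K, x ≠ 0 ∧ x ⬝ᵥ A.mulVec x = 0) ↔
      ∃ x : Fin n → K, x ≠ 0 ∧ x ⬝ᵥ D.mulVec x = 0 := by
  have key : ∀ x : Fin n → K, x ⬝ᵥ D.mulVec x = (P *ᵥ x) ⬝ᵥ A.mulVec (P *ᵥ x) := by
    intro x
    rw [← h, ← Matrix.mulVec_mulVec, ← Matrix.mulVec_mulVec, Matrix.dotProduct_mulVec,
      Matrix.vecMul_transpose]
  constructor
  · rintro ⟨x, hx, hA⟩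
    have e : P *ᵥ (P⁻¹ *ᵥ x) = x := by
      rw [Matrix.mulVec_mulVec, Matrix.mul_nonsing_inv P hP, Matrix.one_mulVec]
    refine ⟨P⁻¹ *ᵥ x, fun h0 => hx ?_, ?_⟩
    · rw [← e, h0, Matrix.mulVec_zero]
    · rw [key, e, hA]
  · rintro ⟨x, hx, hA⟩
    refine ⟨P *ᵥ x, fun h0 => hx ?_, by rw [← key, hA]⟩
    rw [← Matrix.one_mulVec x, ← Matrix.nonsing_inv_mul P hP, ← Matrix.mulVec_mulVec, h0,
      Matrix.mulVec_zero]

lemma iso_int {K : Type} [Field K] [CharZero K] {n : ℕ} (w : Fin n → ℚ) :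
    (∃ x : Fin n → K, x ≠ 0 ∧ x ⬝ᵥ ((Matrix.diagonal w).map (Rat.cast : ℚ → K)).mulVec x = 0) ↔
      Iso K (fun i => (w i).num * ((w i).den : ℤ)) := by
  have hd : ∀ i, ((w i).den : K) ≠ 0 := fun i => by exact_mod_cast (w i).den_ne_zero
  have hw : ∀ i, (w i : K) = (w i).num / (w i).den := fun i => Rat.cast_def (w i)
  have e : ∀ x : Fin n → K, x ⬝ᵥ ((Matrix.diagonal w).map (Rat.cast : ℚ → K)).mulVec x =
      ∑ i, (w i : K) * x i ^ 2 := by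
    intro x
    rw [Matrix.diagonal_map (by simp), dotProduct]
    refine Finset.sum_congr rfl (fun i _ => ?_)
    rw [Matrix.mulVec_diagonal]
    ring
  simp only [e]
  constructor
  · rintro ⟨x, hx, h⟩
    refine ⟨fun i => x i / (w i).den, fun h0 => hx ?_, ?_⟩
    · ext i
      simpa [hd i] using congrFun h0 i
    · rw [← h]
      refine Finset.sum_congr rfl (fun i _ => ?_)
      have := hd i
      rw [hw]; push_cast; field_simp
  · rintro ⟨x, hx, h⟩
    refine ⟨fun i => x i * (w i).den, fun h0 => hx ?_, ?_⟩
    · ext i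
      simpa [hd i] using congrFun h0 i
    · rw [← h]
      refine Finset.sum_congr rfl (fun i _ => ?_)
      have := hd i
      rw [hw]; push_cast; field_simp

lemma iso_field {n : ℕ} {A P : Matrix (Fin n) (Fin n) ℚ} {w : Fin n → ℚ} (hP : IsUnit P.det)
    (h : Pᵀ * A * P = Matrix.diagonal w) (K : Type) [Field K] [CharZero K] :
    (∃ x : Fin n → K, x ≠ 0 ∧ x ⬝ᵥ (A.map (Rat.cast : ℚ → K)).mulVec x = 0) ↔
      Iso K (fun i => (w i).num * ((w i).den : ℤ)) := by
  rw [← iso_int]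
  apply iso_congr (P := P.map (Rat.castHom K))
  · have := hP.map (Rat.castHom K)
    rwa [RingHom.map_det, RingHom.mapMatrix_apply] at this
  · have := congrArg (fun M => M.map (Rat.castHom K)) h
    simp only [Matrix.map_mul] at this
    exact this

end HM

open Matrix

theorem stmt_2 (n : ℕ) (A : Matrix (Fin n) (Fin n) ℚ)
    (hsym : Aᵀ = A) (hdet : A.det ≠ 0) :
    (∃ x : Fin n → ℚ, x ≠ 0 ∧ x ⬝ᵥ A.mulVec x = 0) ↔
      ((∃ x : Fin n → ℝ, x ≠ 0 ∧ x ⬝ᵥ (A.map (Rat.cast : ℚ → ℝ)).mulVec x = 0) ∧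
        ∀ (p : ℕ) [Fact p.Prime],
          ∃ x : Fin n → ℚ_[p], x ≠ 0 ∧ x ⬝ᵥ (A.map (Rat.cast : ℚ → ℚ_[p])).mulVec x = 0) := by
  obtain ⟨P, w, hP, h⟩ := HM.exists_diag A hsym
  have hw : ∀ i, w i ≠ 0 := by
    have h1 := congrArg Matrix.det h
    rw [Matrix.det_mul, Matrix.det_mul, Matrix.det_transpose, Matrix.det_diagonal] at h1
    have h2 : ∏ i, w i ≠ 0 := by
      rw [← h1]
      exact mul_ne_zero (mul_ne_zero hP.ne_zero hdet) hP.ne_zero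
    exact fun i => Finset.prod_ne_zero_iff.mp h2 i (Finset.mem_univ i)
  have hQ := HM.iso_field hP h ℚ
  have hid : A.map (Rat.cast : ℚ → ℚ) = A := by ext i j; simp
  rw [hid] at hQ
  rw [hQ, HM.iso_field hP h ℝ]
  have hpp := fun (p : ℕ) [Fact p.Prime] => HM.iso_field hP h ℚ_[p]
  have cast : ∀ (K : Type) [Field K] [CharZero K] (c : Fin n → ℤ), HM.Iso ℚ c → HM.Iso K c := by
    rintro K _ _ c ⟨x, hx, hs⟩
    refine ⟨fun i => (x i : K), fun h0 => hx ?_, ?_⟩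
    · ext i
      simpa using congrFun h0 i
    · have h2 := congrArg (Rat.castHom K) hs
      simpa using h2
  constructor
  · exact fun H => ⟨cast _ _ H, fun p _ => (hpp p).mpr (cast _ _ H)⟩
  · rintro ⟨H1, H2⟩
    exact HM.hasse n _ (fun i => mul_ne_zero (Rat.num_ne_zero.mpr (hw i))
      (by exact_mod_cast (w i).den_ne_zero)) H1 (fun p _ => (hpp p).mp (H2 p))
end

section
/- (Weak Hasse principle.) Two nondegenerate quadratic forms q₁ and q₂ on ℚⁿ are equivalent over ℚ (i.e., there is a linear isometry between the corresponding quadratic spaces) if and only if their base changes to ℝ are equivalent over ℝ and, for every prime p, their base changes to ℚ_p are equivalent over ℚ_p. -/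
namespace WeakHasse

/-! ### Quadratic forms attached to lists, Witt cancellation -/

section forms
variable {F : Type} [Field F]

/-- The one-dimensional form `a x²`. -/
noncomputable def sqf (a : F) : QuadraticForm F F := a • QuadraticMap.sq

@[simp] lemma sqf_apply (a x : F) : sqf a x = a * x ^ 2 := by
  simp [sqf, pow_two]

/-- The diagonal form attached to a list. -/
noncomputable def qf (l : List F) : QuadraticForm F (Fin l.length → F) :=
  QuadraticMap.weightedSumSquares F l.get

lemma qf_cons_apply (a : F) (l : List F) (x : Fin (l.length + 1) → F) :
    qf (a :: l) x = a * x 0 ^ 2 + qf l (fun i => x i.succ) := by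
  unfold qf
  rw [QuadraticMap.weightedSumSquares_apply, QuadraticMap.weightedSumSquares_apply]
  erw [Fin.sum_univ_succ]
  simp [pow_two]

lemma qf_cons (a : F) (l : List F) :
    (qf (a :: l)).Equivalent ((sqf a).prod (qf l)) := by
  refine ⟨⟨(Fin.consLinearEquiv F (fun _ : Fin (l.length + 1) => F)).symm, ?_⟩⟩
  intro x
  have h := qf_cons_apply a l x
  simp only [List.length_cons] at *
  rw [h]
  simp [Fin.consLinearEquiv]
  rfl

theorem witt_cancel (h2 : (2 : F) ≠ 0) {V V' : Type} [AddCommGroup V] [Module F V]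
    [AddCommGroup V'] [Module F V'] [FiniteDimensional F V] [FiniteDimensional F V']
    (Q : QuadraticForm F V) (Q' : QuadraticForm F V') {a : F} (ha : a ≠ 0)
    (h : ((sqf a).prod Q).Equivalent ((sqf a).prod Q')) : Q.Equivalent Q' := by
  obtain ⟨φ⟩ := h
  set α : F := (φ (1, 0)).1 with hα
  set w : V' := (φ (1, 0)).2 with hw
  let lam : V →ₗ[F] F := (LinearMap.fst F F V') ∘ₗ φ.toLinearEquiv.toLinearMap ∘ₗ
    (LinearMap.inr F F V)
  let T : V →ₗ[F] V' := (LinearMap.snd F F V') ∘ₗ φ.toLinearEquiv.toLinearMap ∘ₗ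
    (LinearMap.inr F F V)
  have hφ : ∀ s v, φ (s, v) = (s * α + lam v, s • w + T v) := by
    intro s v
    have : ((s, v) : F × V) = s • ((1 : F), (0 : V)) + (0, v) := by simp
    rw [this, map_add, map_smul]
    ext <;> simp [lam, T, hα, hw]
  have key : ∀ s v, a * (s * α + lam v) ^ 2 + Q' (s • w + T v) = a * s ^ 2 + Q v := by
    intro s v
    have := φ.map_app (s, v)
    rw [hφ] at this
    simpa using this
  have e : ∀ s v, Q' (s • w + T v) =
      s ^ 2 * Q' w + Q' (T v) + s * QuadraticMap.polar Q' w (T v) := by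
    intro s v
    rw [QuadraticMap.map_add Q', QuadraticMap.polar_smul_left, QuadraticMap.map_smul]
    simp only [smul_eq_mul]; ring
  have k1 : a * α ^ 2 + Q' w = a := by
    have := key 1 0; simpa using this
  have k2 : ∀ v, a * lam v ^ 2 + Q' (T v) = Q v := by
    intro v; have := key 0 v; simpa using this
  have k3 : ∀ v, 2 * a * α * lam v + QuadraticMap.polar Q' w (T v) = 0 := by
    intro v
    have h1 := key 1 v
    rw [e] at h1
    linear_combination h1 - k1 - k2 v
  obtain ⟨ε, c, hε, hc⟩ : ∃ ε c : F, ε ^ 2 = 1 ∧ c * (ε - α) = 1 := by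
    by_cases h1 : α = 1
    · refine ⟨-1, -(1/2), by ring, ?_⟩
      rw [h1]; field_simp; ring
    · have h1' : 1 - α ≠ 0 := fun h => h1 (by linear_combination -h)
      exact ⟨1, 1/(1-α), by ring, by field_simp⟩
  let ψ : V →ₗ[F] V' := T + (c • lam).smulRight w
  have hψ : ∀ v, ψ v = (c * lam v) • w + T v := by
    intro v; simp [ψ, add_comm]
  have iso : ∀ v, Q' (ψ v) = Q v := by
    intro v
    rw [hψ, e]
    linear_combination k2 v + c * lam v * k3 v + c ^ 2 * lam v ^ 2 * k1
      + a * lam v ^ 2 * (c * ε + 1 + α * c) * hc - a * lam v ^ 2 * c ^ 2 * hε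
  have inj : Function.Injective ψ := by
    rw [injective_iff_map_eq_zero]
    intro v hv
    rw [hψ] at hv
    have hT : T v = (-(c * lam v)) • w := by
      rw [neg_smul]; exact eq_neg_of_add_eq_zero_right hv
    have h3 := k3 v
    rw [hT, QuadraticMap.polar_smul_right, QuadraticMap.polar_self] at h3
    have hl : lam v = 0 := by
      have h4 : a * 2 * ε * lam v = 0 := by
        simp only [nsmul_eq_mul, smul_eq_mul, Nat.cast_ofNat] at h3
        linear_combination -h3 - 2 * c * lam v * k1 - 2 * a * lam v * (ε + α) * hc
          + 2 * a * lam v * c * hε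
      have hε0 : ε ≠ 0 := by rintro rfl; simp at hε
      simpa [ha, h2, hε0] using h4
    have : φ (0, v) = 0 := by
      rw [hφ, hT, hl]; simp
    have := φ.toLinearEquiv.map_eq_zero_iff.1 this
    exact congrArg Prod.snd this
  have hdim : Module.finrank F V = Module.finrank F V' := by
    have := φ.toLinearEquiv.finrank_eq
    simpa using this
  exact ⟨⟨LinearMap.linearEquivOfInjective ψ inj hdim, iso⟩⟩

/-- Isometry of the diagonal forms attached to two lists. -/
def Iso (l l' : List F) : Prop := (qf l).Equivalent (qf l')

lemma Iso.refl (l : List F) : Iso l l := QuadraticMap.Equivalent.refl _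
lemma Iso.symm {l l' : List F} (h : Iso l l') : Iso l' l := QuadraticMap.Equivalent.symm h
lemma Iso.trans {l l' l'' : List F} (h : Iso l l') (h' : Iso l' l'') : Iso l l'' :=
  QuadraticMap.Equivalent.trans h h'

lemma Iso.length_eq {l l' : List F} (h : Iso l l') : l.length = l'.length := by
  obtain ⟨φ⟩ := h
  simpa using φ.toLinearEquiv.finrank_eq

lemma Iso.cons (a : F) {l l' : List F} (h : Iso l l') : Iso (a :: l) (a :: l') :=
  ((qf_cons a l).trans (QuadraticMap.Equivalent.prod (QuadraticMap.Equivalent.refl _) h)).trans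
    (qf_cons a l').symm

lemma Iso.of_cons (h2 : (2 : F) ≠ 0) {a : F} (ha : a ≠ 0) {l l' : List F}
    (h : Iso (a :: l) (a :: l')) : Iso l l' :=
  witt_cancel h2 _ _ ha (((qf_cons a l).symm.trans h).trans (qf_cons a l'))

lemma qf_append (l l' : List F) : (qf (l ++ l')).Equivalent ((qf l).prod (qf l')) := by
  induction l with
  | nil =>
    have : Unique (Fin ([] : List F).length → F) := inferInstanceAs (Unique (Fin 0 → F))
    refine ⟨⟨LinearEquiv.symm (LinearEquiv.uniqueProd), ?_⟩⟩
    intro x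
    have : qf ([] : List F) = 0 := by ext; simp [qf]
    simp [this]
  | cons a l ih =>
    refine (qf_cons a _).trans (((QuadraticMap.Equivalent.refl _).prod ih).trans
      (QuadraticMap.Equivalent.trans ?_ ((qf_cons a l).symm.prod (QuadraticMap.Equivalent.refl _))))
    refine ⟨⟨(LinearEquiv.prodAssoc F F _ _).symm, ?_⟩⟩
    rintro ⟨x, y, z⟩
    simp [add_assoc]
    rfl

lemma Iso.append {l₁ l₁' l₂ l₂' : List F} (h : Iso l₁ l₁') (h' : Iso l₂ l₂') :
    Iso (l₁ ++ l₂) (l₁' ++ l₂') :=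
  ((qf_append _ _).trans (QuadraticMap.Equivalent.prod h h')).trans (qf_append _ _).symm

lemma Iso.append_comm (l l' : List F) : Iso (l ++ l') (l' ++ l) :=
  ((qf_append _ _).trans ⟨QuadraticMap.IsometryEquiv.prodComm _ _⟩).trans (qf_append _ _).symm

lemma Iso.swap (a b : F) (l : List F) : Iso (a :: b :: l) (b :: a :: l) :=
  Iso.append (Iso.append_comm [a] [b]) (Iso.refl l)

lemma Iso.sq (a : F) {b : F} (hb : b ≠ 0) (l : List F) : Iso (a * b ^ 2 :: l) (a :: l) := by
  refine (qf_cons _ l).trans (QuadraticMap.Equivalent.trans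
    (QuadraticMap.Equivalent.prod ?_ (QuadraticMap.Equivalent.refl _)) (qf_cons _ l).symm)
  refine ⟨⟨LinearEquiv.smulOfNeZero F F b hb, ?_⟩⟩
  intro x
  simp
  ring

lemma qf_pair (a b : F) : (qf [a, b]).Equivalent ((sqf a).prod (sqf b)) := by
  refine (qf_cons a _).trans ((QuadraticMap.Equivalent.refl _).prod ?_)
  have : Unique (Fin ([] : List F).length → F) := inferInstanceAs (Unique (Fin 0 → F))
  refine (qf_cons b _).trans ⟨⟨LinearEquiv.prodUnique, ?_⟩⟩
  intro x
  have : qf ([] : List F) = 0 := by ext; simp [qf]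
  rcases x with ⟨x, y⟩
  simp [this]

/-- Criterion for isometry of binary forms. -/
lemma Iso.pair {a b c d : F} (x y z w : F) (hdet : x * w - y * z ≠ 0)
    (h1 : a * x ^ 2 + b * z ^ 2 = c) (h2 : a * y ^ 2 + b * w ^ 2 = d)
    (h3 : a * x * y + b * z * w = 0) : Iso [c, d] [a, b] := by
  refine (qf_pair c d).trans (QuadraticMap.Equivalent.trans ?_ (qf_pair a b).symm)
  let f : (F × F) →ₗ[F] (F × F) :=
    { toFun := fun v => (x * v.1 + y * v.2, z * v.1 + w * v.2)
      map_add' := by intro u v; ext <;> simp <;> ring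
      map_smul' := by intro u v; ext <;> simp <;> ring }
  have inj : Function.Injective f := by
    rw [injective_iff_map_eq_zero]
    rintro ⟨u, v⟩ huv
    have e1 : x * u + y * v = 0 := congrArg Prod.fst huv
    have e2 : z * u + w * v = 0 := congrArg Prod.snd huv
    have hu : (x * w - y * z) * u = 0 := by linear_combination w * e1 - y * e2
    have hv : (x * w - y * z) * v = 0 := by linear_combination x * e2 - z * e1
    simp only [mul_eq_zero, hdet, false_or] at hu hv
    simp [hu, hv]
  refine ⟨⟨LinearEquiv.ofInjectiveEndo f inj, ?_⟩⟩
  rintro ⟨u, v⟩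
  simp [f]
  linear_combination u ^ 2 * h1 + v ^ 2 * h2 + 2 * u * v * h3

lemma Iso.add {a b : F} (hab : a + b ≠ 0) (l : List F) :
    Iso (a :: b :: l) ((a + b) :: a * b * (a + b) :: l) := by
  refine Iso.symm (Iso.append (Iso.pair 1 (-b) 1 a ?_ ?_ ?_ ?_) (Iso.refl l))
  · intro h; apply hab; linear_combination h
  all_goals ring

lemma Iso.hyp (h2 : (2 : F) ≠ 0) {a : F} (ha : a ≠ 0) : Iso [a, -a] [1, -1] := by
  refine Iso.pair ((1 + a) / 2) ((1 - a) / 2) ((1 - a) / 2) ((1 + a) / 2) ?_ ?_ ?_ ?_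
  · intro h; apply ha; field_simp at h; ring_nf at h
    have h4 : (4 : F) ≠ 0 := by
      rw [show (4 : F) = 2 * 2 by norm_num]; exact mul_ne_zero h2 h2
    simpa [h4] using h
  all_goals field_simp; ring

/-! ### The Witt group, by generators and relations -/

variable (F) in
/-- Defining relations of the Witt group (with the convention `⟨0⟩ = 0`). -/
def rels : Set (FreeAbelianGroup F) :=
  {x | x = FreeAbelianGroup.of 0} ∪
  {x | ∃ a b : F, b ≠ 0 ∧ x = FreeAbelianGroup.of (a * b ^ 2) - FreeAbelianGroup.of a} ∪
  {x | ∃ a b : F, x = FreeAbelianGroup.of a + FreeAbelianGroup.of b -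
    (FreeAbelianGroup.of (a + b) + FreeAbelianGroup.of (a * b * (a + b)))}

variable (F) in
/-- The Witt group. -/
abbrev W : Type := FreeAbelianGroup F ⧸ AddSubgroup.closure (rels F)

/-- The class of a one-dimensional form. -/
def cl (a : F) : W F := QuotientAddGroup.mk (FreeAbelianGroup.of a)

@[simp] lemma cl_zero : cl (0 : F) = 0 := by
  rw [cl, QuotientAddGroup.eq_zero_iff]
  exact AddSubgroup.subset_closure (Or.inl (Or.inl rfl))

lemma cl_sq (a : F) {b : F} (hb : b ≠ 0) : cl (a * b ^ 2) = cl a := by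
  rw [← sub_eq_zero, cl, cl, ← QuotientAddGroup.mk_sub, QuotientAddGroup.eq_zero_iff]
  exact AddSubgroup.subset_closure (Or.inl (Or.inr ⟨a, b, hb, rfl⟩))

lemma cl_add (a b : F) : cl a + cl b = cl (a + b) + cl (a * b * (a + b)) := by
  rw [← sub_eq_zero]
  simp only [cl, ← QuotientAddGroup.mk_sub, ← QuotientAddGroup.mk_add]
  rw [QuotientAddGroup.eq_zero_iff]
  exact AddSubgroup.subset_closure (Or.inr ⟨a, b, rfl⟩)

lemma cl_neg (a : F) : cl (-a) = - cl a := by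
  have := cl_add a (-a)
  simp only [add_neg_cancel, mul_zero, cl_zero, add_zero] at this
  exact (neg_eq_of_add_eq_zero_right this).symm

/-- Universal property of the Witt group. -/
def lift {A : Type} [AddCommGroup A] (f : F → A) (h0 : f 0 = 0)
    (hsq : ∀ a b, b ≠ 0 → f (a * b ^ 2) = f a)
    (hadd : ∀ a b, f a + f b = f (a + b) + f (a * b * (a + b))) : W F →+ A :=
  QuotientAddGroup.lift _ (FreeAbelianGroup.lift f) (by
    rw [AddSubgroup.closure_le]
    rintro x ((h | ⟨a, b, hb, h⟩) | ⟨a, b, h⟩)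
    · rw [Set.mem_ofPred_eq] at h; subst h; simpa using h0
    · subst h; simp [hsq a b hb]
    · subst h; simp [hadd a b])

@[simp] lemma lift_cl {A : Type} [AddCommGroup A] (f : F → A) (h0 : f 0 = 0)
    (hsq : ∀ a b, b ≠ 0 → f (a * b ^ 2) = f a)
    (hadd : ∀ a b, f a + f b = f (a + b) + f (a * b * (a + b))) (a : F) :
    lift f h0 hsq hadd (cl a) = f a := by
  simp [lift, cl]

/-- Functoriality of the Witt group. -/
def mapW {K : Type} [Field K] (i : F →+* K) : W F →+ W K :=
  lift (fun a => cl (i a)) (by simp)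
    (by intro a b hb; simp only [map_mul, map_pow]; exact cl_sq _ (by simpa using hb))
    (by intro a b; simp only [map_mul, map_add]; exact cl_add _ _)

@[simp] lemma mapW_cl {K : Type} [Field K] (i : F →+* K) (a : F) : mapW i (cl a) = cl (i a) := by
  simp [mapW]

lemma W_induction {P : W F → Prop} (h0 : P 0) (hcl : ∀ a, P (cl a)) (hneg : ∀ x, P x → P (-x))
    (hadd : ∀ x y, P x → P y → P (x + y)) (x : W F) : P x := by
  obtain ⟨x, rfl⟩ := QuotientAddGroup.mk_surjective x
  induction x using FreeAbelianGroup.induction_on with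
  | zero => exact h0
  | of a => exact hcl a
  | neg a h => exact hneg _ (hcl a)
  | add x y hx hy => exact hadd _ _ hx hy

/-- Class of a list. -/
def clL (l : List F) : W F := (l.map cl).sum

@[simp] lemma clL_nil : clL ([] : List F) = 0 := rfl
@[simp] lemma clL_cons (a : F) (l : List F) : clL (a :: l) = cl a + clL l := by
  simp [clL]

lemma represents (l : List F) : ∀ (x : Fin l.length → F), (∀ a ∈ l, a ≠ 0) → qf l x ≠ 0 →
    ∃ l' : List F, (∀ a ∈ l', a ≠ 0) ∧ Iso l (qf l x :: l') ∧ clL l = cl (qf l x) + clL l' := by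
  induction l with
  | nil => intro x _ h; exact absurd (by simp [qf]) h
  | cons a l ih =>
    intro x hl hx
    have hq := qf_cons_apply a l x
    set c := qf (a :: l) x with hc
    set r := qf l (fun i => x i.succ) with hr
    have ha : a ≠ 0 := hl a (by simp)
    have hl' : ∀ b ∈ l, b ≠ 0 := fun b hb => hl b (by simp [hb])
    by_cases hr0 : r = 0
    · have hx0 : x 0 ≠ 0 := by
        intro h; apply hx; rw [hq, hr0, h]; ring
      refine ⟨l, hl', ?_, ?_⟩
      · rw [hq, hr0, add_zero]; exact (Iso.sq a hx0 l).symm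
      · rw [hq, hr0, add_zero, cl_sq a hx0, clL_cons]
    · obtain ⟨l', h1, h2, h3⟩ := ih _ hl' hr0
      rw [← hr] at h2 h3
      by_cases hx0 : x 0 = 0
      · have hcr : c = r := by rw [hq, hx0]; ring
        refine ⟨a :: l', ?_, ?_, ?_⟩
        · simpa [ha] using h1
        · rw [hcr]; exact (h2.cons a).trans (Iso.swap _ _ _)
        · rw [hcr, clL_cons, clL_cons, h3]; abel
      · rw [hq] at hx
        refine ⟨(a * x 0 ^ 2) * r * (a * x 0 ^ 2 + r) :: l', ?_, ?_, ?_⟩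
        · simp only [List.mem_cons, forall_eq_or_imp]
          exact ⟨by positivity, h1⟩
        · rw [hq]
          exact ((Iso.sq a hx0 l).symm.trans (h2.cons _)).trans (Iso.add hx l')
        · rw [hq, clL_cons, clL_cons, h3, ← cl_sq a hx0, ← add_assoc, ← add_assoc, ← cl_add]

/-- Isometric diagonal forms have the same class in the Witt group. -/
theorem clL_eq_of_iso (h2 : (2 : F) ≠ 0) : ∀ (l' l : List F), (∀ a ∈ l, a ≠ 0) →
    (∀ a ∈ l', a ≠ 0) → Iso l l' → clL l = clL l' := by
  intro l'
  induction l' with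
  | nil =>
    intro l _ _ h
    have := h.length_eq
    simp at this
    rw [this]
  | cons c l' ih =>
    intro l hl hl' h
    have hc : c ≠ 0 := hl' c (by simp)
    obtain ⟨φ⟩ := id h.symm
    obtain ⟨x, hx⟩ : ∃ x, qf l x = c := by
      refine ⟨φ (Fin.cons 1 0 : Fin (l'.length + 1) → F), ?_⟩
      rw [φ.map_app]
      refine (qf_cons_apply c l' _).trans ?_
      have : qf l' (fun i => (Fin.cons 1 0 : Fin (l'.length + 1) → F) i.succ) = 0 := by
        simp only [Fin.cons_succ]
        exact QuadraticMap.map_zero _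
      rw [this]; simp
    obtain ⟨m, h1, h3, h4⟩ := represents l x hl (by rwa [hx])
    rw [hx] at h3 h4
    rw [h4, clL_cons, ih m h1 (fun b hb => hl' b (by simp [hb]))
      (Iso.of_cons h2 hc (h3.symm.trans h))]

/-! ### Soundness: equality of classes and of lengths gives an isometry -/

variable (F) in
/-- Isometry as a setoid on lists of units. -/
def isoSetoid : Setoid (List Fˣ) where
  r l l' := Iso (l.map (Units.val)) (l'.map Units.val)
  iseqv := ⟨fun _ => Iso.refl _, fun h => h.symm, fun h hh => h.trans hh⟩

variable (F) in
/-- The monoid of isometry classes. -/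
def IsoMon : Type := Quotient (isoSetoid F)

instance : Add (IsoMon F) where
  add := Quotient.map₂ (fun l l' => l ++ l') (by
    intro a b h c d h'
    change Iso _ _
    simp only [List.map_append]
    exact Iso.append h h')

instance : Zero (IsoMon F) where
  zero := Quotient.mk _ []

instance : AddCommMonoid (IsoMon F) where
  nsmul := nsmulRec
  add_assoc := by
    rintro ⟨a⟩ ⟨b⟩ ⟨c⟩
    exact congrArg (Quotient.mk _) (List.append_assoc a b c)
  zero_add := by rintro ⟨a⟩; rfl
  add_zero := by rintro ⟨a⟩; exact congrArg (Quotient.mk _) (List.append_nil a)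
  add_comm := by
    rintro ⟨a⟩ ⟨b⟩
    apply Quotient.sound
    change Iso _ _
    simp only [List.map_append]
    exact Iso.append_comm _ _

/-- Class of a list of units. -/
def im (l : List Fˣ) : IsoMon F := Quotient.mk (isoSetoid F) l

lemma im_append (l l' : List Fˣ) : im (l ++ l') = im l + im l' := rfl
lemma im_nil : im ([] : List Fˣ) = 0 := rfl
lemma im_eq {l l' : List Fˣ} : im l = im l' ↔ Iso (l.map Units.val) (l'.map Units.val) :=
  Quotient.eq (r := isoSetoid F)

lemma im_cancel (h2 : (2 : F) ≠ 0) (l l₁ l₂ : List Fˣ) (h : im (l ++ l₁) = im (l ++ l₂)) :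
    im l₁ = im l₂ := by
  induction l with
  | nil => exact h
  | cons a l ih =>
    apply ih
    rw [im_eq] at h ⊢
    exact Iso.of_cons h2 a.ne_zero h

lemma isCancel (h2 : (2 : F) ≠ 0) : IsCancelAdd (IsoMon F) := by
  have hl : ∀ a b c : IsoMon F, a + b = a + c → b = c := by
    rintro ⟨a⟩ ⟨b⟩ ⟨c⟩ h
    exact im_cancel h2 a b c h
  exact { add_left_cancel := fun a b c h => hl a b c h
          add_right_cancel := fun a b c h => hl a b c (by
            have hbc : b + a = c + a := h
            rwa [add_comm b, add_comm c] at hbc) }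

/-- The dimension, as a homomorphism. -/
def dimHom : IsoMon F →+ ℤ where
  toFun := Quotient.lift (fun l => (l.length : ℤ)) (by
    intro a b h
    have := Iso.length_eq h
    simpa using this)
  map_zero' := rfl
  map_add' := by
    rintro ⟨a⟩ ⟨b⟩
    change (((a ++ b).length : ℕ) : ℤ) = a.length + b.length
    simp

theorem iso_of_clL_eq (h2 : (2 : F) ≠ 0) (l l' : List Fˣ) (hlen : l.length = l'.length)
    (h : clL (l.map Units.val) = clL (l'.map Units.val)) :
    Iso (l.map Units.val) (l'.map Units.val) := by
  classical
  have := isCancel h2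
  let G := Algebra.GrothendieckAddGroup (IsoMon F)
  let o : IsoMon F →+ G := Algebra.GrothendieckAddGroup.of
  let H : G := o (im [1, -1])
  let N : AddSubgroup G := AddSubgroup.zmultiples H
  let f : F → G ⧸ N := fun a => if ha : a = 0 then 0 else
    QuotientAddGroup.mk (o (im [Units.mk0 a ha]))
  have f0 : f 0 = 0 := by simp [f]
  have fu : ∀ a : Fˣ, f a = QuotientAddGroup.mk (o (im [a])) := by
    intro a; simp [f]
  have hyp : ∀ a : Fˣ, f a + f (-a : F) = 0 := by
    intro a
    rw [show (-a : F) = ((-a : Fˣ) : F) by simp, fu, fu, ← QuotientAddGroup.mk_add, ← map_add,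
      ← im_append, QuotientAddGroup.eq_zero_iff]
    have : im ([a] ++ [-a]) = im [1, -1] := by
      rw [im_eq]; simpa using Iso.hyp h2 a.ne_zero
    rw [this]
    exact AddSubgroup.mem_zmultiples H
  let Φ : W F →+ G ⧸ N := lift f f0 (by
      intro a b hb
      by_cases ha : a = 0
      · simp [ha]
      lift a to Fˣ using (isUnit_iff_ne_zero.2 ha)
      lift b to Fˣ using (isUnit_iff_ne_zero.2 hb)
      rw [show (a * b ^ 2 : F) = ((a * b ^ 2 : Fˣ) : F) by simp, fu, fu]
      congr 2
      rw [im_eq]; simpa using Iso.sq (a : F) b.ne_zero [])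
    (by
      intro a b
      by_cases ha : a = 0
      · simp [ha, f0]
      by_cases hb : b = 0
      · simp [hb, f0]
      by_cases hab : a + b = 0
      · rw [hab, mul_zero, f0, eq_neg_of_add_eq_zero_right hab, add_zero]
        exact hyp (Units.mk0 a ha)
      · obtain ⟨c, hc⟩ := (isUnit_iff_ne_zero.2 hab)
        lift a to Fˣ using (isUnit_iff_ne_zero.2 ha)
        lift b to Fˣ using (isUnit_iff_ne_zero.2 hb)
        rw [← hc, show (a * b * c : F) = ((a * b * c : Fˣ) : F) by simp, fu, fu, fu, fu,
          ← QuotientAddGroup.mk_add, ← QuotientAddGroup.mk_add, ← map_add, ← map_add,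
          ← im_append, ← im_append]
        congr 2
        rw [im_eq]
        simpa [hc] using Iso.add hab [])
  have hΦ : ∀ l : List Fˣ, Φ (clL (l.map Units.val)) = QuotientAddGroup.mk (o (im l)) := by
    intro l
    induction l with
    | nil => simp [im_nil]
    | cons a l ih =>
      rw [List.map_cons, clL_cons, map_add, ih, lift_cl, fu, ← QuotientAddGroup.mk_add,
        ← map_add, ← im_append]
      rfl
  have h1 : (QuotientAddGroup.mk (o (im l)) : G ⧸ N) = QuotientAddGroup.mk (o (im l')) := by
    rw [← hΦ, ← hΦ, h]
  rw [QuotientAddGroup.eq] at h1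
  obtain ⟨k, hk⟩ := AddSubgroup.mem_zmultiples_iff.1 h1
  let d : G →+ ℤ := Algebra.GrothendieckAddGroup.lift dimHom
  have hd : ∀ l : List Fˣ, d (o (im l)) = l.length := by
    intro l
    have : d.comp o = dimHom := Algebra.GrothendieckAddGroup.lift.symm_apply_apply dimHom
    exact DFunLike.congr_fun this (im l)
  have hk0 : k = 0 := by
    have := congrArg d hk
    rw [map_zsmul, map_add, map_neg, hd, hd, hd, hlen] at this
    simpa using this
  rw [hk0, zero_smul] at hk
  have h3 : o (im l) = o (im l') := (neg_add_eq_zero.1 hk.symm)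
  exact im_eq.1 (Algebra.GrothendieckAddGroup.of_injective h3)

end forms

/-! ### Residue maps and signature -/

section residue
variable {p : ℕ} [Fact p.Prime]

open Classical in
/-- The residue of a one-dimensional form over `ℚ_p`. -/
noncomputable def rho (a : ℚ_[p]) : W (ZMod p) :=
  if a = 0 ∨ Even a.valuation then 0 else
    if h : ‖a * (p : ℚ_[p]) ^ (-a.valuation)‖ ≤ 1 then
      cl (PadicInt.toZMod (⟨a * (p : ℚ_[p]) ^ (-a.valuation), h⟩ : ℤ_[p])) else 0

lemma p_ne_zero' : (p : ℚ_[p]) ≠ 0 := by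
  exact_mod_cast (Fact.out : p.Prime).ne_zero

lemma rho_eq (k : ℤ) (u : ℤ_[p]ˣ) :
    rho ((p : ℚ_[p]) ^ k * ((u : ℤ_[p]) : ℚ_[p])) =
      if Even k then 0 else cl (PadicInt.toZMod (u : ℤ_[p])) := by
  have hp := p_ne_zero' (p := p)
  have hu : ((u : ℤ_[p]) : ℚ_[p]) ≠ 0 := by
    rw [PadicInt.coe_ne_zero]; exact u.ne_zero
  have hnu : ‖((u : ℤ_[p]) : ℚ_[p])‖ = 1 := by
    simp
  have hvu : (((u : ℤ_[p]) : ℚ_[p])).valuation = 0 := by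
    have h1 := Padic.norm_eq_zpow_neg_valuation hu
    rw [hnu] at h1
    have hp1 : (1 : ℝ) < p := by exact_mod_cast (Fact.out : p.Prime).one_lt
    have := (zpow_eq_one_iff_right₀ (by positivity) hp1.ne').1 h1.symm
    linarith
  have hv : ((p : ℚ_[p]) ^ k * ((u : ℤ_[p]) : ℚ_[p])).valuation = k := by
    rw [Padic.valuation_mul (zpow_ne_zero _ hp) hu, Padic.valuation_zpow, Padic.valuation_p, hvu]
    simp
  have h0 : (p : ℚ_[p]) ^ k * ((u : ℤ_[p]) : ℚ_[p]) ≠ 0 := mul_ne_zero (zpow_ne_zero _ hp) hu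
  have he : (p : ℚ_[p]) ^ k * ((u : ℤ_[p]) : ℚ_[p]) * (p : ℚ_[p]) ^ (-k) = (u : ℤ_[p]) := by
    rw [zpow_neg]; field_simp
  unfold rho
  simp only [hv, he, h0, false_or]
  split_ifs with h1 h2
  · rfl
  · rfl
  · exact absurd hnu.le h2

lemma exists_rep {a : ℚ_[p]} (ha : a ≠ 0) :
    ∃ (k : ℤ) (u : ℤ_[p]ˣ), a = (p : ℚ_[p]) ^ k * ((u : ℤ_[p]) : ℚ_[p]) := by
  have hp := p_ne_zero' (p := p)
  have hn : ‖a * (p : ℚ_[p]) ^ (-a.valuation)‖ = 1 := by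
    rw [norm_mul, norm_zpow, Padic.norm_p, Padic.norm_eq_zpow_neg_valuation ha]
    have : (p : ℝ) ≠ 0 := by exact_mod_cast (Fact.out : p.Prime).ne_zero
    simp only [inv_zpow', neg_neg]
    rw [zpow_neg, inv_mul_cancel₀ (zpow_ne_zero _ this)]
  refine ⟨a.valuation, PadicInt.mkUnits hn, ?_⟩
  rw [PadicInt.mkUnits_eq, zpow_neg]
  field_simp

lemma toZMod_unit_ne (u : ℤ_[p]ˣ) : PadicInt.toZMod (u : ℤ_[p]) ≠ 0 :=
  (u.isUnit.map (PadicInt.toZMod (p := p))).ne_zero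

lemma unit_of_toZMod_ne {z : ℤ_[p]} (h : PadicInt.toZMod z ≠ 0) : ∃ u : ℤ_[p]ˣ, (u : ℤ_[p]) = z := by
  by_contra hz
  have h1 : z ∈ IsLocalRing.maximalIdeal ℤ_[p] := by
    rw [IsLocalRing.mem_maximalIdeal]; exact hz
  rw [← PadicInt.ker_toZMod] at h1
  exact h h1

@[simp] lemma rho_zero : rho (0 : ℚ_[p]) = 0 := by simp [rho]

lemma rho_sq (a b : ℚ_[p]) (hb : b ≠ 0) : rho (a * b ^ 2) = rho a := by
  by_cases ha : a = 0
  · simp [ha]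
  obtain ⟨k, u, rfl⟩ := exists_rep ha
  obtain ⟨j, v, rfl⟩ := exists_rep hb
  have : (p : ℚ_[p]) ^ k * ((u : ℤ_[p]) : ℚ_[p]) * ((p : ℚ_[p]) ^ j * ((v : ℤ_[p]) : ℚ_[p])) ^ 2
      = (p : ℚ_[p]) ^ (k + 2 * j) * (((u * v ^ 2 : ℤ_[p]ˣ) : ℤ_[p]) : ℚ_[p]) := by
    rw [zpow_add₀ p_ne_zero', two_mul, zpow_add₀ p_ne_zero']
    push_cast
    ring
  rw [this, rho_eq, rho_eq]
  have h2 : Even (k + 2 * j) ↔ Even k := by simp [Int.even_add]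
  simp only [h2]
  rw [Units.val_mul, Units.val_pow_eq_pow_val, map_mul, map_pow, cl_sq _ (toZMod_unit_ne v)]

lemma rho_add_aux (i : ℤ) (n : ℕ) (u v : ℤ_[p]ˣ) :
    rho ((p : ℚ_[p]) ^ i * ((u : ℤ_[p]) : ℚ_[p])) +
      rho ((p : ℚ_[p]) ^ (i + n) * ((v : ℤ_[p]) : ℚ_[p])) =
    rho ((p : ℚ_[p]) ^ i * ((u : ℤ_[p]) : ℚ_[p]) +
      (p : ℚ_[p]) ^ (i + n) * ((v : ℤ_[p]) : ℚ_[p])) +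
    rho ((p : ℚ_[p]) ^ i * ((u : ℤ_[p]) : ℚ_[p]) *
      ((p : ℚ_[p]) ^ (i + n) * ((v : ℤ_[p]) : ℚ_[p])) *
      ((p : ℚ_[p]) ^ i * ((u : ℤ_[p]) : ℚ_[p]) +
      (p : ℚ_[p]) ^ (i + n) * ((v : ℤ_[p]) : ℚ_[p]))) := by
  have hp := p_ne_zero' (p := p)
  obtain ⟨z, hz⟩ : ∃ z : ℤ_[p], z = u + (p : ℤ_[p]) ^ n * v := ⟨_, rfl⟩
  have hs : (p : ℚ_[p]) ^ i * ((u : ℤ_[p]) : ℚ_[p]) +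
      (p : ℚ_[p]) ^ (i + n) * ((v : ℤ_[p]) : ℚ_[p]) = (p : ℚ_[p]) ^ i * (z : ℚ_[p]) := by
    rw [zpow_add₀ hp, zpow_natCast, hz]; push_cast; ring
  rw [hs]
  -- formulas once `z = p ^ k * w`
  have hform : ∀ (k : ℕ) (w : ℤ_[p]ˣ), z = (p : ℤ_[p]) ^ k * w →
      rho ((p : ℚ_[p]) ^ i * (z : ℚ_[p])) =
        (if Even (i + k) then 0 else cl (PadicInt.toZMod (w : ℤ_[p]))) ∧
      rho ((p : ℚ_[p]) ^ i * ((u : ℤ_[p]) : ℚ_[p]) *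
        ((p : ℚ_[p]) ^ (i + n) * ((v : ℤ_[p]) : ℚ_[p])) * ((p : ℚ_[p]) ^ i * (z : ℚ_[p]))) =
        (if Even (i + n + k) then 0 else cl (PadicInt.toZMod (u : ℤ_[p]) *
          PadicInt.toZMod (v : ℤ_[p]) * PadicInt.toZMod (w : ℤ_[p]))) := by
    intro k w hw
    constructor
    · rw [← rho_eq]; congr 1
      rw [hw, zpow_add₀ hp, zpow_natCast]; push_cast; ring
    · have : (p : ℚ_[p]) ^ i * ((u : ℤ_[p]) : ℚ_[p]) *
        ((p : ℚ_[p]) ^ (i + n) * ((v : ℤ_[p]) : ℚ_[p])) * ((p : ℚ_[p]) ^ i * (z : ℚ_[p])) =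
        ((p : ℚ_[p]) ^ (i + n + k) * (((u * v * w : ℤ_[p]ˣ) : ℤ_[p]) : ℚ_[p])) *
          ((p : ℚ_[p]) ^ i) ^ 2 := by
        rw [hw, zpow_add₀ hp (i + n), zpow_natCast]; push_cast; ring
      rw [this, rho_sq _ _ (zpow_ne_zero _ hp), rho_eq]
      simp
  have htz : PadicInt.toZMod z =
      PadicInt.toZMod (u : ℤ_[p]) + (if n = 0 then PadicInt.toZMod (v : ℤ_[p]) else 0) := by
    rw [hz, map_add, map_mul, map_pow, map_natCast, CharP.cast_eq_zero]
    split_ifs with h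
    · simp [h]
    · simp [h]
  by_cases htz0 : PadicInt.toZMod z = 0
  · -- the residues cancel
    have hn : n = 0 := by
      by_contra hn
      simp only [hn, if_false, add_zero] at htz
      exact toZMod_unit_ne u (htz ▸ htz0)
    subst hn
    simp only [if_true] at htz
    have hv : PadicInt.toZMod (v : ℤ_[p]) = - PadicInt.toZMod (u : ℤ_[p]) := by
      rw [htz] at htz0; exact eq_neg_of_add_eq_zero_right htz0
    have hl : rho ((p : ℚ_[p]) ^ i * ((u : ℤ_[p]) : ℚ_[p])) +
      rho ((p : ℚ_[p]) ^ (i + (0 : ℕ)) * ((v : ℤ_[p]) : ℚ_[p])) = 0 := by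
      rw [rho_eq, rho_eq, hv, cl_neg]
      simp only [Nat.cast_zero, add_zero]
      split_ifs <;> simp
    rw [hl]
    by_cases hz0 : z = 0
    · simp [hz0]
    · obtain ⟨h1, h2⟩ := hform z.valuation (PadicInt.unitCoeff hz0) (by
        rw [mul_comm]; exact PadicInt.unitCoeff_spec hz0)
      rw [h1, h2, hv]
      simp only [Nat.cast_zero, add_zero]
      split_ifs
      · simp
      · rw [show PadicInt.toZMod (u : ℤ_[p]) * -PadicInt.toZMod (u : ℤ_[p]) *
          PadicInt.toZMod (PadicInt.unitCoeff hz0 : ℤ_[p]) =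
          (-PadicInt.toZMod (PadicInt.unitCoeff hz0 : ℤ_[p])) *
            PadicInt.toZMod (u : ℤ_[p]) ^ 2 by ring, cl_sq _ (toZMod_unit_ne u), cl_neg]
        simp
  · obtain ⟨w, hw⟩ := unit_of_toZMod_ne htz0
    obtain ⟨h1, h2⟩ := hform 0 w (by simp [hw])
    rw [h1, h2, rho_eq, rho_eq, hw, htz]
    by_cases hn : n = 0
    · subst hn
      simp only [Nat.cast_zero, add_zero, if_true]
      split_ifs
      · rfl
      · exact cl_add _ _
    · simp only [Nat.cast_zero, add_zero, hn, if_false]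
      rw [show PadicInt.toZMod (u : ℤ_[p]) * PadicInt.toZMod (v : ℤ_[p]) *
          PadicInt.toZMod (u : ℤ_[p]) = PadicInt.toZMod (v : ℤ_[p]) *
            PadicInt.toZMod (u : ℤ_[p]) ^ 2 by ring, cl_sq _ (toZMod_unit_ne u)]

lemma rho_add (a b : ℚ_[p]) : rho a + rho b = rho (a + b) + rho (a * b * (a + b)) := by
  by_cases ha : a = 0
  · simp [ha]
  by_cases hb : b = 0
  · simp [hb]
  obtain ⟨i, u, rfl⟩ := exists_rep ha
  obtain ⟨j, v, rfl⟩ := exists_rep hb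
  rcases le_total i j with h | h
  · obtain ⟨n, rfl⟩ := Int.le.dest h
    exact rho_add_aux i n u v
  · obtain ⟨n, rfl⟩ := Int.le.dest h
    have := rho_add_aux j n v u
    rw [add_comm (rho _)] at this
    rw [this, add_comm ((p : ℚ_[p]) ^ (j + n) * _)]
    congr 2
    ring

variable (p) in
/-- The residue homomorphism `W(ℚ) → W(𝔽_p)`, factoring over `W(ℚ_p)`. -/
noncomputable def resP : W ℚ_[p] →+ W (ZMod p) := lift rho rho_zero rho_sq rho_add

@[simp] lemma resP_cl (a : ℚ_[p]) : resP p (cl a) = rho a := lift_cl _ _ _ _ _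

end residue

/-- The signature. -/
noncomputable def sgn : W ℝ →+ ℤ := lift (fun a => ((SignType.sign a : SignType) : ℤ)) (by simp)
  (by
    intro a b hb
    have : 0 < b ^ 2 := by positivity
    rw [sign_mul, sign_pos this, mul_one])
  (by
    intro a b
    rw [sign_mul, sign_mul]
    rcases lt_trichotomy a 0 with ha | ha | ha <;> rcases lt_trichotomy b 0 with hb | hb | hb <;>
    rcases lt_trichotomy (a + b) 0 with hc | hc | hc <;>
    first
      | (exfalso; linarith)
      | simp [sign_neg, sign_pos, *])

@[simp] lemma sgn_one : sgn (cl 1) = 1 := by simp [sgn]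

/-! ### The filtration of `W(ℚ)` -/

section global

/-- Nonzero integers all of whose prime divisors are `< k`. -/
def Sm (k : ℕ) : Set ℤ := {m | m ≠ 0 ∧ ∀ q : ℕ, q.Prime → (q : ℤ) ∣ m → q < k}

lemma Sm_mul {k : ℕ} {a b : ℤ} (ha : a ∈ Sm k) (hb : b ∈ Sm k) : a * b ∈ Sm k := by
  refine ⟨mul_ne_zero ha.1 hb.1, fun q hq h => ?_⟩
  rcases (Nat.prime_iff_prime_int.1 hq).dvd_or_dvd h with h | h
  · exact ha.2 q hq h
  · exact hb.2 q hq h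

lemma Sm_small {k : ℕ} {a : ℤ} (h0 : a ≠ 0) (h : |a| < k) : a ∈ Sm k := by
  refine ⟨h0, fun q _ hd => ?_⟩
  have h1 := Int.le_of_dvd (abs_pos.2 h0) ((dvd_abs _ _).2 hd)
  exact_mod_cast lt_of_le_of_lt h1 h

lemma Sm_mono {k l : ℕ} (h : k ≤ l) : Sm k ⊆ Sm l :=
  fun _ hm => ⟨hm.1, fun q hq hd => (hm.2 q hq hd).trans_le h⟩

/-- The subgroup generated by the classes of `k`-smooth integers. -/
def L (k : ℕ) : AddSubgroup (W ℚ) := AddSubgroup.closure (Set.image (fun m : ℤ => cl (m : ℚ)) (Sm k))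

lemma mem_L {k : ℕ} {m : ℤ} (h : m ∈ Sm k) : cl (m : ℚ) ∈ L k :=
  AddSubgroup.subset_closure ⟨m, h, rfl⟩

lemma L_mono {k l : ℕ} (h : k ≤ l) : L k ≤ L l :=
  AddSubgroup.closure_mono (Set.image_mono (Sm_mono h))

lemma exists_mem_L (x : W ℚ) : ∃ k, x ∈ L k := by
  induction x using W_induction with
  | h0 => exact ⟨0, zero_mem _⟩
  | hcl a =>
    by_cases ha : a = 0
    · exact ⟨0, by simp [ha]⟩
    have hd : (a.den : ℚ) ≠ 0 := by simp
    have h1 : cl a = cl ((a.num * a.den : ℤ) : ℚ) := by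
      rw [← cl_sq a hd]
      congr 1
      push_cast
      rw [pow_two, ← mul_assoc, Rat.mul_den_eq_num]
    rw [h1]
    have h0 : a.num * a.den ≠ 0 := by
      apply mul_ne_zero
      · simpa using ha
      · simp
    refine ⟨(a.num * a.den).natAbs + 1, mem_L (Sm_small h0 ?_)⟩
    push_cast
    linarith
  | hneg x h => obtain ⟨k, hk⟩ := h; exact ⟨k, neg_mem hk⟩
  | hadd x y hx hy =>
    obtain ⟨k, hk⟩ := hx
    obtain ⟨l, hl⟩ := hy
    exact ⟨max k l, add_mem (L_mono (le_max_left _ _) hk) (L_mono (le_max_right _ _) hl)⟩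

section prime
set_option linter.unusedSectionVars false
variable {p : ℕ} [Fact p.Prime]

lemma not_dvd_of_Sm {a : ℤ} (h : a ∈ Sm p) : ¬ (p : ℤ) ∣ a :=
  fun hd => lt_irrefl _ (h.2 p Fact.out hd)

lemma emod_pos_of_Sm {a : ℤ} (h : a ∈ Sm p) : 0 < a % p ∧ a % p < p := by
  have hp : (0 : ℤ) < p := by exact_mod_cast (Fact.out : p.Prime).pos
  refine ⟨lt_of_le_of_ne (Int.emod_nonneg _ hp.ne') ?_, Int.emod_lt_of_pos _ hp⟩
  intro h0
  exact not_dvd_of_Sm h (Int.dvd_of_emod_eq_zero h0.symm)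

lemma emod_Sm {a : ℤ} (h : a ∈ Sm p) : a % p ∈ Sm p := by
  obtain ⟨h1, h2⟩ := emod_pos_of_Sm h
  exact Sm_small h1.ne' (by rwa [abs_of_pos h1])

/-- Class in the quotient `W(ℚ) / L_p`. -/
def QL (p : ℕ) : Type := W ℚ ⧸ L p

noncomputable instance (p : ℕ) : AddCommGroup (QL p) :=
  inferInstanceAs (AddCommGroup (W ℚ ⧸ L p))

/-- The projection. -/
noncomputable def pr (p : ℕ) : W ℚ →+ QL p := QuotientAddGroup.mk' (L p)

lemma pr_eq_zero {p : ℕ} {x : W ℚ} : pr p x = 0 ↔ x ∈ L p :=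
  QuotientAddGroup.eq_zero_iff x

/-- Class of an integer in the quotient. -/
noncomputable def qc (p : ℕ) (m : ℤ) : QL p := pr p (cl (m : ℚ))

lemma qc_add (a b : ℤ) : qc p a + qc p b = qc p (a + b) + qc p (a * b * (a + b)) := by
  simp only [qc, ← map_add]
  rw [cl_add]
  push_cast
  rfl

lemma qc_sq (a : ℤ) {b : ℤ} (hb : b ≠ 0) : qc p (a * b ^ 2) = qc p a := by
  unfold qc
  push_cast
  rw [cl_sq _ (by exact_mod_cast hb)]

lemma qc_Sm {a : ℤ} (h : a ∈ Sm p) : qc p a = 0 := by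
  rw [qc, pr_eq_zero]
  exact mem_L h

lemma qc_zero : qc p 0 = 0 := by simp [qc, cl_zero]

/-- Reduction modulo `p` of a product of two small integers. -/
lemma qc_step {a b m : ℤ} (hm : m ∈ Sm p) (ha0 : a ≠ 0) (ha : |a| < p) (hb0 : b ≠ 0)
    (hb : |b| < p) : qc p (p * m * (a * b)) = qc p (p * m * (a * b % p)) := by
  have hp0 : (p : ℤ) ≠ 0 := by exact_mod_cast (Fact.out : p.Prime).ne_zero
  have hp : (0 : ℤ) < p := by positivity
  have hab : a * b ∈ Sm p := Sm_mul (Sm_small ha0 ha) (Sm_small hb0 hb)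
  obtain ⟨hc0, hc⟩ := emod_pos_of_Sm hab
  have hcS := emod_Sm hab
  have hdiv := Int.emod_add_mul_ediv (a * b) p
  set c := a * b % p
  set d := a * b / p
  have hd : |d| < p := by
    have h1 : |a * b| ≤ (p - 1) * (p - 1) := by
      rw [abs_mul]
      exact mul_le_mul (by linarith) (by linarith) (abs_nonneg _) (by linarith)
    have h2 := abs_le.1 h1
    rw [abs_lt]
    constructor
    · by_contra h
      push Not at h
      nlinarith
    · by_contra h
      push Not at h
      nlinarith
  have h := qc_add (p := p) (p * m * c) (p ^ 2 * m * d)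
  rw [show (p : ℤ) * m * c + p ^ 2 * m * d = p * m * (a * b) by rw [← hdiv]; ring] at h
  rw [show (p : ℤ) ^ 2 * m * d = m * d * p ^ 2 by ring, qc_sq _ hp0,
    show (p : ℤ) * m * c * (m * d * p ^ 2) * (p * m * (a * b)) =
      m * c * d * (a * b) * (p ^ 2 * m) ^ 2 by ring,
    qc_sq _ (mul_ne_zero (pow_ne_zero _ hp0) hm.1)] at h
  by_cases hd0 : d = 0
  · rw [hd0, mul_zero, mul_zero, zero_mul, qc_zero] at h
    rw [add_zero, add_zero] at h
    exact h.symm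
  · have hdS : d ∈ Sm p := Sm_small hd0 hd
    rw [qc_Sm (Sm_mul hm hdS), qc_Sm (Sm_mul (Sm_mul (Sm_mul hm hcS) hdS) hab)] at h
    rw [add_zero, add_zero] at h
    exact h.symm

lemma qc_step' {a u : ℤ} (ha0 : a ≠ 0) (ha : |a| < p) (hu : u ∈ Sm p)
    (h : ∀ m ∈ Sm p, qc p (p * m * u) = qc p (p * m * (u % p))) :
    ∀ m ∈ Sm p, qc p (p * m * (a * u)) = qc p (p * m * (a * u % p)) := by
  intro m hm
  obtain ⟨h1, h2⟩ := emod_pos_of_Sm hu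
  have e1 := h (m * a) (Sm_mul hm (Sm_small ha0 ha))
  have e2 := qc_step hm ha0 ha h1.ne' (by rwa [abs_of_pos h1])
  rw [show (p : ℤ) * m * (a * u) = p * (m * a) * u by ring, e1,
    show (p : ℤ) * (m * a) * (u % p) = p * m * (a * (u % p)) by ring, e2]
  congr 2
  simp [Int.mul_emod]

lemma qc_red_nat (u : ℕ) : (u : ℤ) ∈ Sm p →
    ∀ m ∈ Sm p, qc p (p * m * u) = qc p (p * m * (u % p)) := by
  induction u using induction_on_primes with
  | zero => intro h; exact absurd rfl h.1
  | one =>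
    intro _ m _
    have : (1 : ℤ) < p := by exact_mod_cast (Fact.out : p.Prime).one_lt
    rw [Nat.cast_one, Int.emod_eq_of_lt (by norm_num) this]
  | prime_mul q u hq ih =>
    intro h
    have hq' : q < p := h.2 q hq (by push_cast; exact dvd_mul_right _ _)
    have hu : (u : ℤ) ∈ Sm p := by
      refine ⟨?_, fun r hr hd => h.2 r hr (by push_cast; exact dvd_mul_of_dvd_right hd _)⟩
      have := h.1
      push_cast at this
      exact right_ne_zero_of_mul this
    have := qc_step' (a := q) (by exact_mod_cast hq.ne_zero) (by simpa using hq') hu (ih hu)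
    push_cast
    exact this

lemma neg_one_Sm : (-1 : ℤ) ∈ Sm p :=
  Sm_small (by norm_num) (by simpa using (Fact.out : p.Prime).one_lt)

lemma one_Sm : (1 : ℤ) ∈ Sm p :=
  Sm_small (by norm_num) (by simpa using (Fact.out : p.Prime).one_lt)

lemma qc_red {u : ℤ} (hu : u ∈ Sm p) : qc p (p * u) = qc p (p * (u % p)) := by
  have key : ∀ m ∈ Sm p, qc p (p * m * u) = qc p (p * m * (u % p)) := by
    rcases Int.eq_nat_or_neg u with ⟨n, rfl | rfl⟩
    · exact qc_red_nat n hu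
    · have hn : (n : ℤ) ∈ Sm p := by simpa using Sm_mul neg_one_Sm hu
      have := qc_step' (a := -1) (by norm_num)
        (by simpa using (Fact.out : p.Prime).one_lt) hn (qc_red_nat n hn)
      simpa using this
  simpa using key 1 one_Sm

/-- The section `W(𝔽_p) → W(ℚ)/L_p` on generators. -/
noncomputable def sec0 (u : ZMod p) : QL p := qc p (p * u.val)

lemma sec0_intCast {u : ℤ} (hu : u ∈ Sm p) : qc p (p * u) = sec0 (u : ZMod p) := by
  rw [sec0, ZMod.val_intCast, qc_red hu]

lemma sec0_zero : sec0 (0 : ZMod p) = 0 := by simp [sec0, qc_zero]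

lemma val_Sm {a : ZMod p} (ha : a ≠ 0) : (a.val : ℤ) ∈ Sm p := by
  refine Sm_small ?_ ?_
  · have := (ZMod.val_ne_zero a).2 ha
    omega
  · have := ZMod.val_lt a
    rw [abs_of_nonneg (by positivity)]
    omega

lemma sec0_sq (a b : ZMod p) (hb : b ≠ 0) : sec0 (a * b ^ 2) = sec0 a := by
  by_cases ha : a = 0
  · simp [ha]
  have h := sec0_intCast (Sm_mul (val_Sm ha) (Sm_mul (val_Sm hb) (val_Sm hb)))
  have h' := sec0_intCast (val_Sm ha)
  have e : (((a.val : ℤ) * ((b.val : ℤ) * (b.val : ℤ)) : ℤ) : ZMod p) = a * b ^ 2 := by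
    push_cast; simp [pow_two]
  have e' : ((a.val : ℤ) : ZMod p) = a := by push_cast; simp
  rw [e] at h
  rw [e'] at h'
  rw [← h, ← h', show (p : ℤ) * (a.val * (b.val * b.val)) = p * a.val * b.val ^ 2 by ring,
    qc_sq _ (val_Sm hb).1]

lemma sec0_add (a b : ZMod p) :
    sec0 a + sec0 b = sec0 (a + b) + sec0 (a * b * (a + b)) := by
  by_cases ha : a = 0
  · rw [ha, zero_mul, zero_mul, sec0_zero, zero_add]
    rw [zero_add, add_zero]
  by_cases hb : b = 0
  · rw [hb, mul_zero, zero_mul, sec0_zero, add_zero, add_zero, add_zero]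
  have hp0 : (p : ℤ) ≠ 0 := by exact_mod_cast (Fact.out : p.Prime).ne_zero
  obtain ⟨u, hu⟩ : ∃ u : ℤ, u = a.val := ⟨_, rfl⟩
  obtain ⟨v, hv⟩ : ∃ v : ℤ, v = b.val - p := ⟨_, rfl⟩
  have hu1 : 0 < u := by
    have := (val_Sm ha).1; omega
  have hu2 : u < p := by have := ZMod.val_lt a; omega
  have hv1 : -p < v := by
    have := (val_Sm hb).1; omega
  have hv2 : v < 0 := by have := ZMod.val_lt b; omega
  have hua : (u : ZMod p) = a := by rw [hu]; push_cast; simp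
  have hvb : (v : ZMod p) = b := by rw [hv]; push_cast; simp
  have huS : u ∈ Sm p := Sm_small hu1.ne' (by rw [abs_lt]; constructor <;> linarith)
  have hvS : v ∈ Sm p := Sm_small hv2.ne (by rw [abs_lt]; constructor <;> linarith)
  rw [← hua, ← hvb, ← sec0_intCast huS, ← sec0_intCast hvS, qc_add]
  by_cases huv : u + v = 0
  · have h0 : (u : ZMod p) + v = 0 := by rw [← Int.cast_add, huv, Int.cast_zero]
    have h1 : (p : ℤ) * u + p * v = 0 := by rw [← mul_add, huv, mul_zero]
    rw [h0, h1]
    simp [qc_zero, sec0_zero]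
  · have hS : u + v ∈ Sm p := Sm_small huv (by rw [abs_lt]; constructor <;> linarith)
    have e1 := sec0_intCast hS
    have e2 := sec0_intCast (Sm_mul (Sm_mul huS hvS) hS)
    push_cast at e1 e2
    rw [← e1, ← e2, ← mul_add, show (p : ℤ) * u * (p * v) * (p * (u + v)) =
      p * (u * v * (u + v)) * p ^ 2 by ring, qc_sq _ hp0]

variable (p) in
/-- The section `W(𝔽_p) → W(ℚ)/L_p`. -/
noncomputable def secP : W (ZMod p) →+ QL p := lift sec0 sec0_zero sec0_sq sec0_add

variable (p) in
/-- The residue map on `W(ℚ)`. -/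
noncomputable def resQ : W ℚ →+ W (ZMod p) := (resP p).comp (mapW (Rat.castHom ℚ_[p]))

lemma intCast_unit {m : ℤ} (h : m ∈ Sm p) : ∃ u : ℤ_[p]ˣ, (u : ℤ_[p]) = (m : ℤ_[p]) := by
  apply unit_of_toZMod_ne
  rw [map_intCast, Ne, ZMod.intCast_zmod_eq_zero_iff_dvd]
  exact not_dvd_of_Sm h

lemma sec_res {m : ℤ} (hm : m ∈ Sm (p + 1)) : secP p (resQ p (cl (m : ℚ))) = qc p m := by
  have hpp : p.Prime := Fact.out
  have hp0 : (p : ℤ) ≠ 0 := by exact_mod_cast hpp.ne_zero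
  obtain ⟨k, n, hn, hmn⟩ : ∃ (k : ℕ) (n : ℤ), ¬ (p : ℤ) ∣ n ∧ m = p ^ k * n := by
    have hfin : FiniteMultiplicity (p : ℤ) m := by
      rw [Int.finiteMultiplicity_iff]
      exact ⟨by simpa using hpp.ne_one, hm.1⟩
    obtain ⟨n, h1, h2⟩ := hfin.exists_eq_pow_mul_and_not_dvd
    exact ⟨_, n, h2, h1⟩
  have hnS : n ∈ Sm p := by
    refine ⟨?_, fun q hq hd => ?_⟩
    · rintro rfl; simp at hn
    · have h1 := hm.2 q hq (by rw [hmn]; exact dvd_mul_of_dvd_right hd _)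
      have h2 : q ≠ p := by rintro rfl; exact hn hd
      omega
  obtain ⟨u, hu⟩ := intCast_unit hnS
  have hres : resQ p (cl (m : ℚ)) = if Even (k : ℤ) then 0 else cl (n : ZMod p) := by
    have h3 : ((Rat.castHom ℚ_[p]) (m : ℚ)) = (p : ℚ_[p]) ^ (k : ℤ) * ((u : ℤ_[p]) : ℚ_[p]) := by
      rw [hu, hmn]; simp
    rw [resQ, AddMonoidHom.comp_apply, mapW_cl, resP_cl, h3, rho_eq, hu, map_intCast]
  rw [hres]
  rcases Nat.even_or_odd' k with ⟨j, hj | hj⟩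
  · rw [if_pos (by rw [hj]; simp), map_zero, hmn, hj,
      show (p : ℤ) ^ (2 * j) * n = n * (p ^ j) ^ 2 by ring, qc_sq _ (pow_ne_zero _ hp0), qc_Sm hnS]
  · rw [if_neg (by rw [hj]; simp), hmn, hj,
      show (p : ℤ) ^ (2 * j + 1) * n = p * n * (p ^ j) ^ 2 by ring, qc_sq _ (pow_ne_zero _ hp0),
      sec0_intCast hnS]
    exact lift_cl _ _ _ _ _

lemma mem_L_of_res {x : W ℚ} (hx : x ∈ L (p + 1)) (h : resQ p x = 0) : x ∈ L p := by
  have key : ∀ y ∈ L (p + 1), secP p (resQ p y) = pr p y := by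
    intro y hy
    have hle : L (p + 1) ≤ AddMonoidHom.eqLocus ((secP p).comp (resQ p))
        (pr p) := by
      unfold L
      rw [AddSubgroup.closure_le]
      rintro _ ⟨m, hm, rfl⟩
      exact sec_res hm
    exact hle hy
  have := key x hx
  rw [h, map_zero] at this
  exact pr_eq_zero.1 this.symm

end prime

/-- An element of `W(ℚ)` with trivial residues and signature vanishes. -/
theorem eq_zero_of_local {x : W ℚ} (hr : ∀ (p : ℕ) [Fact p.Prime], resQ p x = 0)
    (hs : sgn (mapW (Rat.castHom ℝ) x) = 0) : x = 0 := by
  have h1 : ∀ k, x ∈ L k → x ∈ L 0 := by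
    intro k
    induction k with
    | zero => exact id
    | succ k ih =>
      intro hx
      apply ih
      by_cases hk : k.Prime
      · have : Fact k.Prime := ⟨hk⟩
        exact mem_L_of_res hx (hr k)
      · have : Sm (k + 1) ⊆ Sm k := by
          intro m hm
          refine ⟨hm.1, fun q hq hd => ?_⟩
          have h1 := hm.2 q hq hd
          have h2 : q ≠ k := by rintro rfl; exact hk hq
          omega
        exact AddSubgroup.closure_mono (Set.image_mono this) hx
  obtain ⟨k, hk⟩ := exists_mem_L x
  have h2 := h1 k hk
  have h3 : L 0 ≤ AddSubgroup.zmultiples (cl (1 : ℚ)) := by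
    unfold L
    rw [AddSubgroup.closure_le]
    rintro _ ⟨m, hm, rfl⟩
    have : m.natAbs = 1 := by
      by_contra h
      obtain ⟨q, hq, hd⟩ := Nat.exists_prime_and_dvd h
      exact absurd (hm.2 q hq (Int.natCast_dvd.2 hd)) (by omega)
    rcases Int.natAbs_eq_iff.1 this with rfl | rfl
    · simp
    · simp [cl_neg]
  obtain ⟨n, rfl⟩ := AddSubgroup.mem_zmultiples_iff.1 (h3 h2)
  rw [map_zsmul, map_zsmul, mapW_cl, map_one, sgn_one] at hs
  have : n = 0 := by simpa using hs
  simp [this]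

end global

section bridge

/-- Matrix congruence. -/
def Cong {F : Type} [Field F] {n : ℕ} (A B : Matrix (Fin n) (Fin n) F) : Prop :=
  ∃ M : Matrix (Fin n) (Fin n) F, IsUnit M.det ∧ M.transpose * A * M = B

variable {F : Type} [Field F] {n : ℕ}

lemma Cong.symm {A B : Matrix (Fin n) (Fin n) F} (h : Cong A B) : Cong B A := by
  obtain ⟨M, hM, rfl⟩ := h
  refine ⟨M⁻¹, by simpa using hM, ?_⟩
  have h1 : M * M⁻¹ = 1 := Matrix.mul_nonsing_inv _ hM
  have h2 : M⁻¹.transpose * M.transpose = 1 := by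
    rw [← Matrix.transpose_mul, h1, Matrix.transpose_one]
  calc M⁻¹.transpose * (M.transpose * A * M) * M⁻¹
      = (M⁻¹.transpose * M.transpose) * A * (M * M⁻¹) := by simp only [Matrix.mul_assoc]
    _ = A := by rw [h1, h2, Matrix.one_mul, Matrix.mul_one]

lemma Cong.trans {A B C : Matrix (Fin n) (Fin n) F} (h : Cong A B) (h' : Cong B C) :
    Cong A C := by
  obtain ⟨M, hM, rfl⟩ := h
  obtain ⟨N, hN, rfl⟩ := h'
  refine ⟨M * N, by rw [Matrix.det_mul]; exact hM.mul hN, ?_⟩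
  simp only [Matrix.transpose_mul, Matrix.mul_assoc]

lemma Cong.map {K : Type} [Field K] (i : F →+* K) {A B : Matrix (Fin n) (Fin n) F}
    (h : Cong A B) : Cong (A.map i) (B.map i) := by
  obtain ⟨M, hM, rfl⟩ := h
  refine ⟨M.map i, ?_, ?_⟩
  · have := hM.map i
    rwa [RingHom.map_det] at this
  · simp only [Matrix.map_mul, Matrix.transpose_map]

/-- The quadratic form of a matrix. -/
noncomputable def mq (A : Matrix (Fin n) (Fin n) F) : QuadraticForm F (Fin n → F) :=
  A.toQuadraticForm'

lemma mq_apply (A : Matrix (Fin n) (Fin n) F) (x : Fin n → F) :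
    mq A x = dotProduct x (A.mulVec x) := by
  simp [mq, Matrix.toQuadraticForm', Matrix.toLinearMap₂'_apply']

lemma mq_diagonal (w : Fin n → F) :
    mq (Matrix.diagonal w) = QuadraticMap.weightedSumSquares F w := by
  ext x
  rw [mq_apply, QuadraticMap.weightedSumSquares_apply]
  simp only [dotProduct, Matrix.mulVec_diagonal, smul_eq_mul]
  exact Finset.sum_congr rfl fun i _ => by ring

lemma mq_comp (A M : Matrix (Fin n) (Fin n) F) (x : Fin n → F) :
    mq (M.transpose * A * M) x = mq A (M.mulVec x) := by
  rw [mq_apply, mq_apply, ← Matrix.mulVec_mulVec, ← Matrix.mulVec_mulVec,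
    Matrix.dotProduct_mulVec, Matrix.vecMul_transpose]

lemma equiv_of_cong {A B : Matrix (Fin n) (Fin n) F} (h : Cong A B) :
    (mq B).Equivalent (mq A) := by
  obtain ⟨M, hM, rfl⟩ := h
  refine ⟨⟨M.toLinearEquiv' (M.invertibleOfIsUnitDet hM), ?_⟩⟩
  intro x
  exact (mq_comp A M x).symm

lemma mq_injective (h2 : (2 : F) ≠ 0) {A B : Matrix (Fin n) (Fin n) F}
    (hA : A.transpose = A) (hB : B.transpose = B) (h : ∀ x, mq A x = mq B x) : A = B := by
  have key : ∀ (C : Matrix (Fin n) (Fin n) F), C.transpose = C → ∀ i j,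
      mq C (Pi.single i 1 + Pi.single j 1) - mq C (Pi.single i 1) - mq C (Pi.single j 1)
        = 2 * C i j := by
    intro C hC i j
    have hji : C j i = C i j := congrFun (congrFun hC i) j
    simp only [mq_apply, Matrix.mulVec_add, dotProduct_add, add_dotProduct,
      Matrix.mulVec_single_one, single_one_dotProduct, Matrix.col_apply, hji]
    ring
  ext i j
  have := key A hA i j
  rw [h, h, h, key B hB] at this
  exact (mul_left_cancel₀ h2 this).symm

lemma cong_of_equiv (h2 : (2 : F) ≠ 0) {A B : Matrix (Fin n) (Fin n) F}
    (hA : A.transpose = A) (hB : B.transpose = B)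
    (h : (mq B).Equivalent (mq A)) : Cong A B := by
  obtain ⟨e⟩ := h
  refine ⟨LinearMap.toMatrix' (e.toLinearEquiv : (Fin n → F) →ₗ[F] (Fin n → F)), ?_, ?_⟩
  · rw [LinearMap.det_toMatrix']
    exact LinearEquiv.isUnit_det' _
  · apply mq_injective h2
    · simp only [Matrix.transpose_mul, Matrix.transpose_transpose, hA, Matrix.mul_assoc]
    · exact hB
    · intro x
      rw [mq_comp, LinearMap.toMatrix'_mulVec]
      exact e.map_app x

lemma wss_reindex {ι κ : Type} [Fintype ι] [Fintype κ] (e : ι ≃ κ) (w : κ → F) :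
    (QuadraticMap.weightedSumSquares F w).Equivalent
      (QuadraticMap.weightedSumSquares F (w ∘ e)) := by
  refine ⟨⟨LinearEquiv.funCongrLeft F F e, ?_⟩⟩
  intro x
  change QuadraticMap.weightedSumSquares F (w ∘ e) (x ∘ e) = _
  simp only [QuadraticMap.weightedSumSquares_apply, Function.comp]
  exact Equiv.sum_comp e (fun i => w i • (x i * x i))

lemma qf_ofFn (w : Fin n → F) :
    (qf (List.ofFn w)).Equivalent (QuadraticMap.weightedSumSquares F w) := by
  have := wss_reindex (F := F) (finCongr (List.length_ofFn (f := w))) w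
  refine QuadraticMap.Equivalent.symm ?_
  convert this using 1
  unfold qf
  congr 1
  ext i
  simp [finCongr]
  rfl

lemma iso_iff_cong (h2 : (2 : F) ≠ 0) (v w : Fin n → F) :
    Iso (List.ofFn v) (List.ofFn w) ↔ Cong (Matrix.diagonal v) (Matrix.diagonal w) := by
  constructor
  · intro h
    apply cong_of_equiv h2 (Matrix.diagonal_transpose _) (Matrix.diagonal_transpose _)
    rw [mq_diagonal, mq_diagonal]
    exact (qf_ofFn w).symm.trans (QuadraticMap.Equivalent.trans (Iso.symm h) (qf_ofFn v))
  · intro h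
    have := equiv_of_cong h
    rw [mq_diagonal, mq_diagonal] at this
    exact (qf_ofFn v).trans (this.symm.trans (qf_ofFn w).symm)

lemma exists_diag (h2 : (2 : F) ≠ 0) {A : Matrix (Fin n) (Fin n) F}
    (hA : A.transpose = A) (hd : A.det ≠ 0) :
    ∃ w : Fin n → Fˣ, Cong A (Matrix.diagonal fun i => (w i : F)) := by
  have : Invertible (2 : F) := invertibleOfNonzero h2
  obtain ⟨v, hv⟩ := QuadraticForm.equivalent_weightedSumSquares (mq A)
  have hn : n = Module.finrank F (Fin n → F) := by simp
  have hv' := hv.trans (wss_reindex (finCongr hn) v)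
  rw [← mq_diagonal] at hv'
  have hc := cong_of_equiv h2 hA (Matrix.diagonal_transpose _) hv'.symm
  have hne : ∀ i, (v ∘ finCongr hn) i ≠ 0 := by
    obtain ⟨M, hM, hE⟩ := hc
    have h := congrArg Matrix.det hE
    rw [Matrix.det_mul, Matrix.det_mul, Matrix.det_transpose, Matrix.det_diagonal] at h
    have h3 : M.det * A.det * M.det ≠ 0 := mul_ne_zero (mul_ne_zero hM.ne_zero hd) hM.ne_zero
    rw [h] at h3
    intro i
    exact Finset.prod_ne_zero_iff.1 h3 i (Finset.mem_univ i)
  exact ⟨fun i => Units.mk0 _ (hne i), hc⟩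

lemma mapW_clL {K : Type} [Field K] (i : F →+* K) (l : List F) :
    mapW i (clL l) = clL (l.map i) := by
  induction l with
  | nil => simp [clL_nil]
  | cons a l ih => rw [clL_cons, map_add, ih, List.map_cons, clL_cons, mapW_cl]

lemma mapW_eq {K : Type} [Field K] (h2 : (2 : K) ≠ 0) (i : F →+* K) (v w : Fin n → Fˣ)
    (h : Cong ((Matrix.diagonal fun j => (v j : F)).map i)
      ((Matrix.diagonal fun j => (w j : F)).map i)) :
    mapW i (clL (List.ofFn fun j => (v j : F))) = mapW i (clL (List.ofFn fun j => (w j : F))) := by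
  rw [Matrix.diagonal_map (map_zero i), Matrix.diagonal_map (map_zero i), ← iso_iff_cong h2] at h
  rw [mapW_clL, mapW_clL, List.map_ofFn, List.map_ofFn]
  refine clL_eq_of_iso h2 _ _ ?_ ?_ h
  · intro a ha
    obtain ⟨j, rfl⟩ := List.mem_ofFn.1 ha
    simp
  · intro a ha
    obtain ⟨j, rfl⟩ := List.mem_ofFn.1 ha
    simp

end bridge

theorem hasse_diag (n : ℕ) (v w : Fin n → ℚˣ)
    (hR : Cong ((Matrix.diagonal fun j => (v j : ℚ)).map (Rat.castHom ℝ))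
      ((Matrix.diagonal fun j => (w j : ℚ)).map (Rat.castHom ℝ)))
    (hP : ∀ (p : ℕ) [Fact p.Prime],
      Cong ((Matrix.diagonal fun j => (v j : ℚ)).map (Rat.castHom ℚ_[p]))
      ((Matrix.diagonal fun j => (w j : ℚ)).map (Rat.castHom ℚ_[p]))) :
    Cong (Matrix.diagonal fun j => (v j : ℚ)) (Matrix.diagonal fun j => (w j : ℚ)) := by
  rw [← iso_iff_cong two_ne_zero]
  have hx : clL (List.ofFn fun j => (v j : ℚ)) - clL (List.ofFn fun j => (w j : ℚ)) = 0 := by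
    apply eq_zero_of_local
    · intro p _
      have := mapW_eq two_ne_zero _ _ _ (hP p)
      rw [resQ, AddMonoidHom.comp_apply, map_sub (mapW _), this, sub_self, map_zero]
    · have := mapW_eq two_ne_zero _ _ _ hR
      rw [map_sub (mapW _), this, sub_self, map_zero]
  have h := iso_of_clL_eq (F := ℚ) two_ne_zero (List.ofFn v) (List.ofFn w) (by simp) (by
    rw [List.map_ofFn, List.map_ofFn]
    exact sub_eq_zero.1 hx)
  rw [List.map_ofFn, List.map_ofFn] at h
  exact h

theorem hasse_matrix (n : ℕ) (A₁ A₂ : Matrix (Fin n) (Fin n) ℚ)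
    (hsym₁ : A₁.transpose = A₁) (hsym₂ : A₂.transpose = A₂)
    (hdet₁ : A₁.det ≠ 0) (hdet₂ : A₂.det ≠ 0) :
    Cong A₁ A₂ ↔ (Cong (A₁.map (Rat.castHom ℝ)) (A₂.map (Rat.castHom ℝ)) ∧
      ∀ (p : ℕ) [Fact p.Prime],
        Cong (A₁.map (Rat.castHom ℚ_[p])) (A₂.map (Rat.castHom ℚ_[p]))) := by
  constructor
  · intro h
    exact ⟨h.map _, fun p _ => h.map _⟩
  · rintro ⟨hR, hP⟩
    obtain ⟨v, hv⟩ := exists_diag two_ne_zero hsym₁ hdet₁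
    obtain ⟨w, hw⟩ := exists_diag two_ne_zero hsym₂ hdet₂
    exact hv.trans ((hasse_diag n v w ((hv.map _).symm.trans (hR.trans (hw.map _)))
      (fun p _ => (hv.map _).symm.trans ((hP p).trans (hw.map _)))).trans hw.symm)

end WeakHasse

open Matrix

/-- **Weak Hasse principle.** Two nondegenerate quadratic forms on `ℚⁿ` (given by
symmetric matrices `A₁`, `A₂`) are equivalent over `ℚ` iff they are equivalent over `ℝ`
and over `ℚ_p` for every prime `p`. -/
theorem stmt_3 (n : ℕ) (A₁ A₂ : Matrix (Fin n) (Fin n) ℚ)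
    (hsym₁ : A₁ᵀ = A₁) (hsym₂ : A₂ᵀ = A₂) (hdet₁ : A₁.det ≠ 0) (hdet₂ : A₂.det ≠ 0) :
    (∃ M : Matrix (Fin n) (Fin n) ℚ, IsUnit M.det ∧ Mᵀ * A₁ * M = A₂) ↔
      ((∃ M : Matrix (Fin n) (Fin n) ℝ, IsUnit M.det ∧
          Mᵀ * A₁.map (Rat.cast : ℚ → ℝ) * M = A₂.map (Rat.cast : ℚ → ℝ)) ∧
        ∀ (p : ℕ) [Fact p.Prime],
          ∃ M : Matrix (Fin n) (Fin n) ℚ_[p], IsUnit M.det ∧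
            Mᵀ * A₁.map (Rat.cast : ℚ → ℚ_[p]) * M = A₂.map (Rat.cast : ℚ → ℚ_[p])) := by
  exact WeakHasse.hasse_matrix n A₁ A₂ hsym₁ hsym₂ hdet₁ hdet₂
end

section
/- The quadratic forms −23x₁² + x₂² + x₃² + x₄² and −55x₁² + x₂² + x₃² + x₄² over ℚ are anisotropic: for each of them, any x ∈ ℚ⁴ at which the form vanishes is zero. -/
theorem sq_cases_aux (x : ℤ) : (∃ y, x = 2 * y ∧ x ^ 2 = 4 * y ^ 2) ∨ (∃ m, x ^ 2 = 8 * m + 1) := by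
  rcases Int.even_or_odd x with ⟨y, hy⟩ | h
  · left
    exact ⟨y, by omega, by rw [hy]; ring⟩
  · right
    obtain ⟨y, rfl⟩ := h
    obtain ⟨z, hz⟩ := Int.even_mul_succ_self y
    exact ⟨z, by linear_combination 4 * hz⟩

theorem descent_aux (N : ℤ) (hN : N = 23 ∨ N = 55) (n : ℕ) : ∀ a b c d : ℤ, a.natAbs = n →
    b ^ 2 + c ^ 2 + d ^ 2 = N * a ^ 2 → a = 0 := by
  induction n using Nat.strong_induction_on with
  | _ n ih =>
    intro a b c d hn h
    by_contra ha
    have key : ∃ a' b' c' d' : ℤ, a = 2 * a' ∧ b' ^ 2 + c' ^ 2 + d' ^ 2 = N * a' ^ 2 := by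
      rcases hN with rfl | rfl <;>
      rcases sq_cases_aux a with ⟨a', ha', ha2⟩ | ⟨a', ha2⟩ <;>
      rcases sq_cases_aux b with ⟨b', hb', hb2⟩ | ⟨b', hb2⟩ <;>
      rcases sq_cases_aux c with ⟨c', hc', hc2⟩ | ⟨c', hc2⟩ <;>
      rcases sq_cases_aux d with ⟨d', hd', hd2⟩ | ⟨d', hd2⟩ <;>
      rw [ha2, hb2, hc2, hd2] at h <;>
      first
      | exact ⟨a', b', c', d', ha', by linarith⟩
      | (exfalso; omega)
    obtain ⟨a', b', c', d', h1, h2⟩ := key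
    have := ih a'.natAbs (by omega) a' b' c' d' rfl h2
    omega

theorem rat_aux (N : ℤ) (hN : N = 23 ∨ N = 55) (x : Fin 4 → ℚ)
    (h : -(N : ℚ) * x 0 ^ 2 + x 1 ^ 2 + x 2 ^ 2 + x 3 ^ 2 = 0) : x = 0 := by
  have h0 : x 0 = 0 := by
    obtain ⟨⟨D, hD⟩, hx⟩ := IsLocalization.exist_integer_multiples_of_finite (nonZeroDivisors ℤ) x
    have hD0 : (D : ℚ) ≠ 0 := by exact_mod_cast nonZeroDivisors.ne_zero hD
    choose y hy using hx
    simp only [zsmul_eq_mul, algebraMap_int_eq, eq_intCast] at hy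
    have hz := descent_aux N hN _ (y 0) (y 1) (y 2) (y 3) rfl (by
      have : ((y 1 : ℚ)) ^ 2 + (y 2 : ℚ) ^ 2 + (y 3 : ℚ) ^ 2 = N * (y 0 : ℚ) ^ 2 := by
        rw [hy, hy, hy, hy]
        linear_combination (D : ℚ) ^ 2 * h
      exact_mod_cast this)
    have := hy 0
    rw [hz] at this
    simpa [hD0] using this.symm
  rw [h0] at h
  have h1 : x 1 = 0 := by nlinarith [sq_nonneg (x 1), sq_nonneg (x 2), sq_nonneg (x 3)]
  have h2 : x 2 = 0 := by nlinarith [sq_nonneg (x 1), sq_nonneg (x 2), sq_nonneg (x 3)]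
  have h3 : x 3 = 0 := by nlinarith [sq_nonneg (x 1), sq_nonneg (x 2), sq_nonneg (x 3)]
  funext i
  fin_cases i <;> assumption

/-- The quadratic forms `-23x₁² + x₂² + x₃² + x₄²` and `-55x₁² + x₂² + x₃² + x₄²`
over `ℚ` are anisotropic. -/
theorem stmt_19 :
    (∀ x : Fin 4 → ℚ, -23 * x 0 ^ 2 + x 1 ^ 2 + x 2 ^ 2 + x 3 ^ 2 = 0 → x = 0) ∧
    (∀ x : Fin 4 → ℚ, -55 * x 0 ^ 2 + x 1 ^ 2 + x 2 ^ 2 + x 3 ^ 2 = 0 → x = 0) := by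
  constructor
  · intro x h
    exact rat_aux 23 (Or.inl rfl) x (by push_cast; exact h)
  · intro x h
    exact rat_aux 55 (Or.inr rfl) x (by push_cast; exact h)
end
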